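/- arXiv:1101.3208 — 9 statements merged into one kernel-verified Lean document; each statement's English description precedes it below -/
import Mathlib

section
/- Let D = f₃(x)D³ + f₂(x)D² + f₁(x)D + f₀(x) and D̄ = f̄₃(x)D³ + f̄₂(x)D² + f̄₁(x)D + f̄₀(x) be third-order linear differential operators with smooth coefficients on ℝ, with f₃ > 0 and f̄₃ > 0 everywhere. Then D and D̄ are directly equivalent — i.e., there exist a smooth diffeomorphism ξ : ℝ → ℝ with ξ' > 0 and a smooth function φ : ℝ → ℝ with φ > 0 such that for every smooth v : ℝ → ℝ and every x ∈ ℝ one has f̄₃(ξ(x))v'''(ξ(x)) + f̄₂(ξ(x))v''(ξ(x)) + f̄₁(ξ(x))v'(ξ(x)) + f̄₀(ξ(x))v(ξ(x)) = f₃(x)·(d/dx)³[v(ξ(x))/φ(x)] + f₂(x)·(d/dx)²[v(ξ(x))/φ(x)] + f₁(x)·(d/dx)[v(ξ(x))/φ(x)] + f₀(x)·v(ξ(x))/φ(x) — if and only if there exist a diffeomorphism Φ : Ω → Ω̄ and smooth functions a₁, …, a₆ : Ω → ℝ with a₁a₃a₆ nowhere zero such that at every point z ∈ Ω the pullbacks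 Φ*ω̄ⁱ (defined by (Φ*ω̄)_z = ω̄_{Φ(z)} ∘ DΦ_z, with DΦ_z the Fréchet derivative) satisfy Φ*ω̄¹ = a₁ω¹, Φ*ω̄² = ω², Φ*ω̄³ = a₂ω² + a₃ω³, Φ*ω̄⁴ = a₄ω² + a₅ω³ + a₆ω⁴, and Φ*ω̄⁵ = ω⁵. -/
noncomputable section

open Real Set

/-- The base space `ℝ⁵` with coordinates `(x, u, p, q, r) = (z 0, z 1, z 2, z 3, z 4)`. -/
abbrev E5 : Type := Fin 5 → ℝ

/-- The coordinate covector `dx`. -/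
def dX : E5 →L[ℝ] ℝ := ContinuousLinearMap.proj 0
/-- The coordinate covector `du`. -/
def dU : E5 →L[ℝ] ℝ := ContinuousLinearMap.proj 1
/-- The coordinate covector `dp`. -/
def dP : E5 →L[ℝ] ℝ := ContinuousLinearMap.proj 2
/-- The coordinate covector `dq`. -/
def dQ : E5 →L[ℝ] ℝ := ContinuousLinearMap.proj 3
/-- The coordinate covector `dr`. -/
def dR : E5 →L[ℝ] ℝ := ContinuousLinearMap.proj 4

/-- Exterior derivative of a 1-form: `dθ_z(v,w) = (Dθ)_z(v)(w) − (Dθ)_z(w)(v)`. -/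
def extD (θ : E5 → E5 →L[ℝ] ℝ) (z v w : E5) : ℝ :=
  fderiv ℝ θ z v w - fderiv ℝ θ z w v

/-- Wedge product of 1-forms evaluated on a pair of vectors. -/
def wedge (α β : E5 → E5 →L[ℝ] ℝ) (z v w : E5) : ℝ :=
  α z v * β z w - α z w * β z v

/-- `ω¹ = dx`. -/
def ω1 : E5 → E5 →L[ℝ] ℝ := fun _ => dX
/-- `ω² = (du − p dx)/u`. -/
def ω2 : E5 → E5 →L[ℝ] ℝ := fun z => (z 1)⁻¹ • (dU - z 2 • dX)
/-- `ω³ = dp − q dx`. -/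
def ω3 : E5 → E5 →L[ℝ] ℝ := fun z => dP - z 3 • dX
/-- `ω⁴ = dq − r dx`. -/
def ω4 : E5 → E5 →L[ℝ] ℝ := fun z => dQ - z 4 • dX

/-- The open set `Ω = {(x,u,p,q,r) : u > 0, f₃(x) > 0}`. -/
def Omega (f3 : ℝ → ℝ) : Set E5 := {z | 0 < z 1 ∧ 0 < f3 (z 0)}

/-- The form `ω⁵ = dI` of the direct equivalence problem. -/
def ω5d (f0 f1 f2 f3 : ℝ → ℝ) : E5 → E5 →L[ℝ] ℝ := fun z =>
  f3 (z 0) • dR + f2 (z 0) • dQ + f1 (z 0) • dP + f0 (z 0) • dU +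
    (deriv f3 (z 0) * z 4 + deriv f2 (z 0) * z 3 + deriv f1 (z 0) * z 2 +
      deriv f0 (z 0) * z 1) • dX

/-- The form `ω⁵ = dI` of the gauge equivalence problem. -/
def ω5g (f0 f1 f2 f3 : ℝ → ℝ) : E5 → E5 →L[ℝ] ℝ := fun z =>
  ((deriv f3 (z 0) * z 4 + deriv f2 (z 0) * z 3 + deriv f1 (z 0) * z 2) / z 1 +
      deriv f0 (z 0)) • dX
    - ((f3 (z 0) * z 4 + f2 (z 0) * z 3 + f1 (z 0) * z 2) / (z 1) ^ 2) • dU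
    + (f1 (z 0) / z 1) • dP + (f2 (z 0) / z 1) • dQ + (f3 (z 0) / z 1) • dR

/-- The function `∑ᵢ kᵢ(x) u⁽ⁱ⁾` on the jet space, where `(u, p, q, r) = (u, u', u'', u''')`. -/
def jetForm (k : Fin 4 → ℝ → ℝ) (z : E5) : ℝ :=
  k 0 (z 0) * z 1 + k 1 (z 0) * z 2 + k 2 (z 0) * z 3 + k 3 (z 0) * z 4

/-- The differential of `jetForm k`. -/
def jetFormD (k : Fin 4 → ℝ → ℝ) (z : E5) : E5 →L[ℝ] ℝ :=
  (deriv (k 0) (z 0) * z 1 + deriv (k 1) (z 0) * z 2 + deriv (k 2) (z 0) * z 3 +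
      deriv (k 3) (z 0) * z 4) • dX +
    k 0 (z 0) • dU + k 1 (z 0) • dP + k 2 (z 0) • dQ + k 3 (z 0) • dR

/-- The coefficients of the total derivative of `jetForm k` divided by `ξ'` (for `k 3 = 0`). -/
def liftCoeff (ξ : ℝ → ℝ) (k : Fin 4 → ℝ → ℝ) : Fin 4 → ℝ → ℝ :=
  ![fun x => deriv (k 0) x / deriv ξ x,
    fun x => (k 0 x + deriv (k 1) x) / deriv ξ x,
    fun x => (k 1 x + deriv (k 2) x) / deriv ξ x,
    fun x => (k 2 x + deriv (k 3) x) / deriv ξ x]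

/-- The coefficients, as functions on the jet space, of the `n`-th `x̄`-derivative of `ū = φ u`
under the change of independent variable `x̄ = ξ(x)`. -/
def prolongCoeff (ξ φ : ℝ → ℝ) : ℕ → Fin 4 → ℝ → ℝ
  | 0 => ![φ, 0, 0, 0]
  | n + 1 => liftCoeff ξ (prolongCoeff ξ φ n)

/-- The third prolongation of `(x, u) ↦ (ξ(x), φ(x) u)`. -/
def prolong (ξ φ : ℝ → ℝ) (z : E5) : E5 :=
  ![ξ (z 0), jetForm (prolongCoeff ξ φ 0) z, jetForm (prolongCoeff ξ φ 1) z,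
    jetForm (prolongCoeff ξ φ 2) z, jetForm (prolongCoeff ξ φ 3) z]

/-- The third jet of `w` at `x`. -/
def jet (w : ℝ → ℝ) (x : ℝ) : E5 :=
  ![x, w x, deriv w x, iteratedDeriv 2 w x, iteratedDeriv 3 w x]

theorem mem_Omega_iff {f : ℝ → ℝ} (hf : ∀ x, 0 < f x) {z : E5} : z ∈ Omega f ↔ 0 < z 1 :=
  ⟨fun h => h.1, fun h => ⟨h, hf _⟩⟩

theorem Omega_eq {f : ℝ → ℝ} (hf : ∀ x, 0 < f x) : Omega f = {z : E5 | 0 < z 1} :=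
  Set.ext fun _ => mem_Omega_iff hf

theorem isOpen_Omega {f : ℝ → ℝ} (hf : ∀ x, 0 < f x) : IsOpen (Omega f) := by
  rw [Omega_eq hf]
  exact isOpen_lt continuous_const (continuous_apply 1)

theorem eq_of_hasFDerivAt_apply_sub_eq_zero {s : Set E5} (hs : Convex ℝ s) {F : E5 → ℝ}
    {F' : E5 → E5 →L[ℝ] ℝ} (hF : ∀ z ∈ s, HasFDerivAt F (F' z) z) {x y : E5} (hx : x ∈ s)
    (hy : y ∈ s) (h0 : ∀ z ∈ s, F' z (y - x) = 0) : F y = F x := by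
  obtain ⟨z, hz, h⟩ := domain_mvt (fun z hz => (hF z hz).hasFDerivWithinAt) hs hx hy
  rw [h0 z (hs.segment_subset hx hy hz)] at h
  exact sub_eq_zero.1 h

theorem ContDiff.deriv_infty {f : ℝ → ℝ} (hf : ContDiff ℝ (⊤ : ℕ∞) f) :
    ContDiff ℝ (⊤ : ℕ∞) (deriv f) :=
  (contDiff_infty_iff_deriv.1 hf).2

theorem ContDiff.differentiable_infty {f : ℝ → ℝ} (hf : ContDiff ℝ (⊤ : ℕ∞) f) :
    Differentiable ℝ f :=
  (contDiff_infty_iff_deriv.1 hf).1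

theorem contDiff_iteratedDeriv_infty {f : ℝ → ℝ} (hf : ContDiff ℝ (⊤ : ℕ∞) f) (n : ℕ) :
    ContDiff ℝ (⊤ : ℕ∞) (iteratedDeriv n f) := by
  induction n with
  | zero => simpa
  | succ n ih => rw [iteratedDeriv_succ]; exact ih.deriv_infty

theorem hasFDerivAt_comp_apply_zero {c : ℝ → ℝ} (hc : Differentiable ℝ c) (z : E5) :
    HasFDerivAt (fun z : E5 => c (z 0)) (deriv c (z 0) • dX) z :=
  (hc (z 0)).hasDerivAt.comp_hasFDerivAt z (hasFDerivAt_apply (𝕜 := ℝ) (0 : Fin 5) z)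

theorem hasFDerivAt_jetForm {k : Fin 4 → ℝ → ℝ} (hk : ∀ i, Differentiable ℝ (k i)) (z : E5) :
    HasFDerivAt (jetForm k) (jetFormD k z) z := by
  have hz : ∀ i, HasFDerivAt (fun z : E5 => z i) (ContinuousLinearMap.proj i : E5 →L[ℝ] ℝ) z :=
    fun i => hasFDerivAt_apply i z
  have hc := fun i => hasFDerivAt_comp_apply_zero (hk i) z
  refine (((((hc 0).mul (hz 1)).add ((hc 1).mul (hz 2))).add ((hc 2).mul (hz 3))).add
    ((hc 3).mul (hz 4))).congr_fderiv ?_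
  ext v
  simp [jetFormD, dX, dU, dP, dQ, dR]
  ring

theorem contDiff_jetForm {k : Fin 4 → ℝ → ℝ} (hk : ∀ i, ContDiff ℝ (⊤ : ℕ∞) (k i)) :
    ContDiff ℝ (⊤ : ℕ∞) (jetForm k) := by
  have hc : ∀ i, ContDiff ℝ (⊤ : ℕ∞) (fun z : E5 => k i (z 0)) := fun i =>
    (hk i).comp (contDiff_apply ℝ ℝ 0)
  have hz : ∀ i, ContDiff ℝ (⊤ : ℕ∞) (fun z : E5 => z i) := fun i => contDiff_apply ℝ ℝ i
  exact ((((hc 0).mul (hz 1)).add ((hc 1).mul (hz 2))).add ((hc 2).mul (hz 3))).add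
    ((hc 3).mul (hz 4))

theorem jetFormD_eq_ω5d (f0 f1 f2 f3 : ℝ → ℝ) (z : E5) :
    jetFormD ![f0, f1, f2, f3] z = ω5d f0 f1 f2 f3 z := by
  ext v
  simp [jetFormD, ω5d, dX, dU, dP, dQ, dR]
  ring

theorem jetFormD_apply {ξ : ℝ → ℝ} {k : Fin 4 → ℝ → ℝ} (hk : k 3 = 0) (z v : E5)
    (hξ : deriv ξ (z 0) ≠ 0) :
    jetFormD k z v = jetForm (liftCoeff ξ k) z * (deriv ξ (z 0) * v 0) +
      k 0 (z 0) * (v 1 - z 2 * v 0) + k 1 (z 0) * (v 2 - z 3 * v 0) +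
      k 2 (z 0) * (v 3 - z 4 * v 0) := by
  simp [jetFormD, jetForm, liftCoeff, dX, dU, dP, dQ, dR, hk]
  field_simp
  ring

/-- The total derivative `∂ₓ + p ∂ᵤ + q ∂ₚ + r ∂_q` of `jetForm k`. -/
theorem jetFormD_total {ξ : ℝ → ℝ} {k : Fin 4 → ℝ → ℝ} (hk : k 3 = 0) (z : E5)
    (hξ : deriv ξ (z 0) ≠ 0) :
    jetFormD k z ![1, z 2, z 3, z 4, 0] = jetForm (liftCoeff ξ k) z * deriv ξ (z 0) := by
  rw [jetFormD_apply hk z _ hξ]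
  simp

theorem contDiff_liftCoeff {ξ : ℝ → ℝ} {k : Fin 4 → ℝ → ℝ} (hξ : ContDiff ℝ (⊤ : ℕ∞) ξ)
    (hξ0 : ∀ x, deriv ξ x ≠ 0) (hk : ∀ i, ContDiff ℝ (⊤ : ℕ∞) (k i)) (i : Fin 4) :
    ContDiff ℝ (⊤ : ℕ∞) (liftCoeff ξ k i) := by
  fin_cases i
  · exact (hk 0).deriv_infty.div hξ.deriv_infty hξ0
  · exact ((hk 0).add (hk 1).deriv_infty).div hξ.deriv_infty hξ0
  · exact ((hk 1).add (hk 2).deriv_infty).div hξ.deriv_infty hξ0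
  · exact ((hk 2).add (hk 3).deriv_infty).div hξ.deriv_infty hξ0

theorem contDiff_prolongCoeff {ξ φ : ℝ → ℝ} (hξ : ContDiff ℝ (⊤ : ℕ∞) ξ)
    (hξ0 : ∀ x, deriv ξ x ≠ 0) (hφ : ContDiff ℝ (⊤ : ℕ∞) φ) (n : ℕ) (i : Fin 4) :
    ContDiff ℝ (⊤ : ℕ∞) (prolongCoeff ξ φ n i) := by
  induction n generalizing i with
  | zero =>
    fin_cases i
    · exact hφ
    all_goals exact contDiff_const
  | succ n ih => exact contDiff_liftCoeff hξ hξ0 ih i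

theorem prolongCoeff_eq_zero (ξ φ : ℝ → ℝ) (n : ℕ) (i : Fin 4) (h : n < i) :
    prolongCoeff ξ φ n i = 0 := by
  induction n generalizing i with
  | zero => fin_cases i <;> simp_all [prolongCoeff]
  | succ n ih =>
    fin_cases i <;> simp at h
    · have h1 := ih 1 (by simp; omega)
      have h2 := ih 2 (by simp; omega)
      ext x
      simp [prolongCoeff, liftCoeff, h1, h2]
    · have h1 := ih 2 (by simp; omega)
      have h2 := ih 3 (by simp; omega)
      ext x
      simp [prolongCoeff, liftCoeff, h1, h2]

theorem prolongCoeff_diag (ξ φ : ℝ → ℝ) (x : ℝ) :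
    prolongCoeff ξ φ 0 0 x = φ x ∧ prolongCoeff ξ φ 1 1 x = φ x / deriv ξ x ∧
    prolongCoeff ξ φ 2 2 x = φ x / deriv ξ x ^ 2 ∧
    prolongCoeff ξ φ 3 3 x = φ x / deriv ξ x ^ 3 := by
  have e0 : prolongCoeff ξ φ 0 0 x = φ x := rfl
  have e1 : prolongCoeff ξ φ 1 1 x = φ x / deriv ξ x := by
    change (prolongCoeff ξ φ 0 0 x + deriv (prolongCoeff ξ φ 0 1) x) / _ = _
    rw [prolongCoeff_eq_zero ξ φ 0 1 (by simp), e0]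
    simp
  have e2 : prolongCoeff ξ φ 2 2 x = φ x / deriv ξ x ^ 2 := by
    change (prolongCoeff ξ φ 1 1 x + deriv (prolongCoeff ξ φ 1 2) x) / _ = _
    rw [prolongCoeff_eq_zero ξ φ 1 2 (by simp), e1]
    simp [div_div, pow_two]
  have e3 : prolongCoeff ξ φ 3 3 x = φ x / deriv ξ x ^ 3 := by
    change (prolongCoeff ξ φ 2 2 x + deriv (prolongCoeff ξ φ 2 3) x) / _ = _
    rw [prolongCoeff_eq_zero ξ φ 2 3 (by simp), e2]
    simp [div_div, pow_succ]
  exact ⟨e0, e1, e2, e3⟩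

theorem hasDerivAt_jetForm_jet {k : Fin 4 → ℝ → ℝ} (hk : ∀ i, Differentiable ℝ (k i))
    (hk3 : k 3 = 0) {w : ℝ → ℝ} (hw : ContDiff ℝ (⊤ : ℕ∞) w) {ξ : ℝ → ℝ} (x : ℝ)
    (hξ0 : deriv ξ x ≠ 0) :
    HasDerivAt (fun t => jetForm k (jet w t)) (jetForm (liftCoeff ξ k) (jet w x) * deriv ξ x) x := by
  have d : ∀ n, HasDerivAt (iteratedDeriv n w) (iteratedDeriv (n + 1) w x) x := fun n => by
    rw [iteratedDeriv_succ]
    exact ((contDiff_iteratedDeriv_infty hw n).differentiable_infty x).hasDerivAt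
  have c : ∀ i, HasDerivAt (k i) (deriv (k i) x) x := fun i => (hk i x).hasDerivAt
  have d0 : HasDerivAt w (deriv w x) x := by simpa using d 0
  have d1 : HasDerivAt (deriv w) (iteratedDeriv 2 w x) x := by simpa using d 1
  have key := (((c 0).mul d0).add ((c 1).mul d1)).add ((c 2).mul (d 2))
  have := jetFormD_total (ξ := ξ) hk3 (jet w x) hξ0
  refine (key.congr_of_eventuallyEq (Filter.Eventually.of_forall fun t => ?_)).congr_deriv ?_
  · simp [jetForm, jet, hk3]
  · rw [show deriv ξ x = deriv ξ (jet w x 0) from rfl, ← this]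
    simp [jetFormD, jet, dX, dU, dP, dQ, dR, hk3]
    ring

theorem deriv_comp_eq_jetForm {k : Fin 4 → ℝ → ℝ} (hk : ∀ i, Differentiable ℝ (k i))
    (hk3 : k 3 = 0) {w h ξ : ℝ → ℝ} (hw : ContDiff ℝ (⊤ : ℕ∞) w) (hh : Differentiable ℝ h)
    (hξ : Differentiable ℝ ξ) (hξ0 : ∀ x, deriv ξ x ≠ 0)
    (H : ∀ x, h (ξ x) = jetForm k (jet w x)) (x : ℝ) :
    deriv h (ξ x) = jetForm (liftCoeff ξ k) (jet w x) := by
  have h1 : HasDerivAt (fun t => h (ξ t)) (deriv h (ξ x) * deriv ξ x) x :=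
    (hh (ξ x)).hasDerivAt.comp x (hξ x).hasDerivAt
  have h2 := hasDerivAt_jetForm_jet hk hk3 hw x (hξ0 x)
  simp_rw [H] at h1
  exact mul_right_cancel₀ (hξ0 x) (h1.unique h2)

theorem jet_comp_eq_prolong {ξ φ v w : ℝ → ℝ} (hξ : ContDiff ℝ (⊤ : ℕ∞) ξ)
    (hξ0 : ∀ x, deriv ξ x ≠ 0) (hφ : ContDiff ℝ (⊤ : ℕ∞) φ) (hv : ContDiff ℝ (⊤ : ℕ∞) v)
    (hw : ContDiff ℝ (⊤ : ℕ∞) w) (H : ∀ x, v (ξ x) = φ x * w x) (x : ℝ) :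
    jet v (ξ x) = prolong ξ φ (jet w x) := by
  have e : ∀ n < 4, ∀ x, iteratedDeriv n v (ξ x) = jetForm (prolongCoeff ξ φ n) (jet w x) := by
    intro n hn
    induction n with
    | zero => intro x; simp [prolongCoeff, jetForm, jet, H]
    | succ n ih =>
      rw [iteratedDeriv_succ]
      exact deriv_comp_eq_jetForm
        (fun i => (contDiff_prolongCoeff hξ hξ0 hφ n i).differentiable_infty)
        (prolongCoeff_eq_zero ξ φ n 3 (by simp; omega)) hw
        (contDiff_iteratedDeriv_infty hv n).differentiable_infty hξ.differentiable_infty hξ0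
        (ih (by omega))
  have e0 := e 0 (by norm_num) x
  have e1 := e 1 (by norm_num) x
  rw [iteratedDeriv_zero] at e0
  rw [iteratedDeriv_one] at e1
  rw [jet, prolong, e0, e1, e 2 (by norm_num), e 3 (by norm_num)]
  rfl

theorem exists_jet_eq (z : E5) : ∃ w : ℝ → ℝ, ContDiff ℝ (⊤ : ℕ∞) w ∧ jet w (z 0) = z := by
  set c := z 0 with hc
  have h0 : ∀ a b e f t : ℝ, HasDerivAt
      (fun t => a + b * (t - c) + e / 2 * (t - c) ^ 2 + f / 6 * (t - c) ^ 3)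
      (b + e * (t - c) + f / 2 * (t - c) ^ 2) t := by
    intro a b e f t
    have hl : HasDerivAt (fun t : ℝ => t - c) 1 t := (hasDerivAt_id t).sub_const c
    refine ((((hasDerivAt_const t a).add (hl.const_mul b)).add ((hl.pow 2).const_mul (e / 2))).add
      ((hl.pow 3).const_mul (f / 6))).congr_deriv ?_
    simp
    ring
  have d1 : deriv (fun t => z 1 + z 2 * (t - c) + z 3 / 2 * (t - c) ^ 2 + z 4 / 6 * (t - c) ^ 3) =
      fun t => z 2 + z 3 * (t - c) + z 4 / 2 * (t - c) ^ 2 := funext fun t => (h0 _ _ _ _ t).deriv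
  have d2 : deriv (fun t => z 2 + z 3 * (t - c) + z 4 / 2 * (t - c) ^ 2) =
      fun t => z 3 + z 4 * (t - c) := funext fun t => by
    simpa using (h0 (z 2) (z 3) (z 4) 0 t).deriv
  have d3 : deriv (fun t => z 3 + z 4 * (t - c)) = fun t => z 4 := funext fun t => by
    simp
  refine ⟨fun t => z 1 + z 2 * (t - c) + z 3 / 2 * (t - c) ^ 2 + z 4 / 6 * (t - c) ^ 3,
    by fun_prop, ?_⟩
  ext i
  fin_cases i
  · exact hc.symm
  · simp [jet]
  · simp [jet, d1]
  · simp [jet, iteratedDeriv_succ, d1, d2]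
  · simp [jet, iteratedDeriv_succ, d1, d2, d3]

/-- The coefficients of the pullback of `jetForm g` under `prolong ξ φ`. -/
def pullCoeff (ξ φ : ℝ → ℝ) (g : Fin 4 → ℝ → ℝ) (i : Fin 4) (x : ℝ) : ℝ :=
  g 0 (ξ x) * prolongCoeff ξ φ 0 i x + g 1 (ξ x) * prolongCoeff ξ φ 1 i x +
    g 2 (ξ x) * prolongCoeff ξ φ 2 i x + g 3 (ξ x) * prolongCoeff ξ φ 3 i x

theorem jetForm_prolong (ξ φ : ℝ → ℝ) (g : Fin 4 → ℝ → ℝ) (z : E5) :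
    jetForm g (prolong ξ φ z) = jetForm (pullCoeff ξ φ g) z := by
  simp only [jetForm, prolong, pullCoeff, Matrix.cons_val]
  ring

theorem pullCoeff_three (ξ φ : ℝ → ℝ) (g : Fin 4 → ℝ → ℝ) (x : ℝ) :
    pullCoeff ξ φ g 3 x = g 3 (ξ x) * (φ x / deriv ξ x ^ 3) := by
  simp [pullCoeff, prolongCoeff_diag, prolongCoeff_eq_zero ξ φ 0 3 (by simp),
    prolongCoeff_eq_zero ξ φ 1 3 (by simp), prolongCoeff_eq_zero ξ φ 2 3 (by simp)]

theorem coeff_eq_of_jetForm_eq {k l : Fin 4 → ℝ → ℝ}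
    (h : ∀ z : E5, 0 < z 1 → jetForm k z = jetForm l z) : k = l := by
  have e (x p q r : ℝ) := h ![x, 1, p, q, r] (by simp)
  simp only [jetForm, Matrix.cons_val] at e
  ext i x
  fin_cases i
  · change k 0 x = l 0 x
    linarith [e x 0 0 0]
  · change k 1 x = l 1 x
    linarith [e x 0 0 0, e x 1 0 0]
  · change k 2 x = l 2 x
    linarith [e x 0 0 0, e x 0 1 0]
  · change k 3 x = l 3 x
    linarith [e x 0 0 0, e x 0 0 1]

theorem exists_contDiff_inverse {ξ : ℝ → ℝ} (hξ : ContDiff ℝ (⊤ : ℕ∞) ξ)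
    (hb : Function.Bijective ξ) (h : ∀ x, 0 < deriv ξ x) :
    ∃ η : ℝ → ℝ, ContDiff ℝ (⊤ : ℕ∞) η ∧ (∀ x, η (ξ x) = x) ∧ ∀ y, ξ (η y) = y := by
  let e := ((strictMono_of_deriv_pos h).orderIsoOfSurjective ξ hb.2).toHomeomorph
  have he : ∀ x, e x = ξ x := fun _ => rfl
  refine ⟨e.symm, e.contDiff_symm_deriv (fun x => (h x).ne')
    (fun x => (hξ.differentiable_infty x).hasDerivAt) hξ, fun x => ?_, fun y => ?_⟩
  · rw [← he, e.symm_apply_apply]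
  · rw [← he, e.apply_symm_apply]

theorem direct_equivalence_iff_pullCoeff {ξ φ : ℝ → ℝ} (f g : Fin 4 → ℝ → ℝ)
    (hξ : ContDiff ℝ (⊤ : ℕ∞) ξ) (hb : Function.Bijective ξ) (hξ0 : ∀ x, 0 < deriv ξ x)
    (hφ : ContDiff ℝ (⊤ : ℕ∞) φ) (hφ0 : ∀ x, 0 < φ x) :
    (∀ v : ℝ → ℝ, ContDiff ℝ (⊤ : ℕ∞) v → ∀ x : ℝ,
      jetForm g (jet v (ξ x)) = jetForm f (jet (fun t => v (ξ t) / φ t) x)) ↔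
    pullCoeff ξ φ g = f := by
  have hξ' : ∀ x, deriv ξ x ≠ 0 := fun x => (hξ0 x).ne'
  have hφ' : ∀ x, φ x ≠ 0 := fun x => (hφ0 x).ne'
  constructor
  · intro H
    obtain ⟨η, hη, h1, -⟩ := exists_contDiff_inverse hξ hb hξ0
    refine coeff_eq_of_jetForm_eq fun z _ => ?_
    obtain ⟨w, hw, hwz⟩ := exists_jet_eq z
    have hv : ContDiff ℝ (⊤ : ℕ∞) fun y => φ (η y) * w (η y) := (hφ.comp hη).mul (hw.comp hη)
    have h2 := H _ hv (z 0)
    rw [jet_comp_eq_prolong hξ hξ' hφ hv hw (fun x => by simp only [h1]), hwz, jetForm_prolong] at h2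
    simp only [h1, mul_div_cancel_left₀ _ (hφ' _)] at h2
    rw [h2]
    exact congrArg _ hwz
  · rintro rfl v hv x
    have hw : ContDiff ℝ (⊤ : ℕ∞) fun t => v (ξ t) / φ t := (hv.comp hξ).div hφ hφ'
    rw [← jetForm_prolong, jet_comp_eq_prolong hξ hξ' hφ hv hw]
    exact fun x => (mul_div_cancel₀ _ (hφ' x)).symm

theorem hasFDerivAt_prolong {ξ φ : ℝ → ℝ} (hξ : ContDiff ℝ (⊤ : ℕ∞) ξ)
    (hξ0 : ∀ x, deriv ξ x ≠ 0) (hφ : ContDiff ℝ (⊤ : ℕ∞) φ) (z : E5) :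
    HasFDerivAt (prolong ξ φ) (ContinuousLinearMap.pi ![deriv ξ (z 0) • dX,
      jetFormD (prolongCoeff ξ φ 0) z, jetFormD (prolongCoeff ξ φ 1) z,
      jetFormD (prolongCoeff ξ φ 2) z, jetFormD (prolongCoeff ξ φ 3) z]) z := by
  have h := fun n => hasFDerivAt_jetForm
    (fun i => (contDiff_prolongCoeff hξ hξ0 hφ n i).differentiable_infty) z
  refine hasFDerivAt_pi.2 fun i => ?_
  fin_cases i
  · exact hasFDerivAt_comp_apply_zero hξ.differentiable_infty z
  · exact h 0
  · exact h 1
  · exact h 2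
  · exact h 3

theorem contDiff_prolong {ξ φ : ℝ → ℝ} (hξ : ContDiff ℝ (⊤ : ℕ∞) ξ)
    (hξ0 : ∀ x, deriv ξ x ≠ 0) (hφ : ContDiff ℝ (⊤ : ℕ∞) φ) :
    ContDiff ℝ (⊤ : ℕ∞) (prolong ξ φ) := by
  have h := fun n => contDiff_jetForm (contDiff_prolongCoeff hξ hξ0 hφ n)
  refine contDiff_pi.2 fun i => ?_
  fin_cases i
  · exact hξ.comp (contDiff_apply ℝ ℝ 0)
  · exact h 0
  · exact h 1
  · exact h 2
  · exact h 3

theorem prolong_one (ξ φ : ℝ → ℝ) (z : E5) : prolong ξ φ z 1 = φ (z 0) * z 1 := by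
  simp [prolong, jetForm, prolongCoeff]

theorem exists_prolong_inverse {ξ φ : ℝ → ℝ} (hξ : ContDiff ℝ (⊤ : ℕ∞) ξ)
    (hb : Function.Bijective ξ) (hξ0 : ∀ x, 0 < deriv ξ x)
    (hφ : ContDiff ℝ (⊤ : ℕ∞) φ) (hφ0 : ∀ x, 0 < φ x) :
    ∃ Ψ : E5 → E5, ContDiff ℝ (⊤ : ℕ∞) Ψ ∧ (∀ z, Ψ (prolong ξ φ z) = z) ∧
      ∀ z, prolong ξ φ (Ψ z) = z := by
  obtain ⟨η, hη, h1, h2⟩ := exists_contDiff_inverse hξ hb hξ0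
  have hc : ∀ n i, ContDiff ℝ (⊤ : ℕ∞) (fun z : E5 => prolongCoeff ξ φ n i (η (z 0))) := fun n i =>
    (contDiff_prolongCoeff hξ (fun x => (hξ0 x).ne') hφ n i).comp
      (hη.comp (contDiff_apply ℝ ℝ 0))
  have hz : ∀ i, ContDiff ℝ (⊤ : ℕ∞) (fun z : E5 => z i) := fun i => contDiff_apply ℝ ℝ i
  have n0 : ∀ x, prolongCoeff ξ φ 0 0 x ≠ 0 := fun x => (hφ0 x).ne'
  have n1 : ∀ x, prolongCoeff ξ φ 1 1 x ≠ 0 := fun x => by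
    rw [(prolongCoeff_diag ξ φ x).2.1]
    exact (div_pos (hφ0 x) (hξ0 x)).ne'
  have n2 : ∀ x, prolongCoeff ξ φ 2 2 x ≠ 0 := fun x => by
    rw [(prolongCoeff_diag ξ φ x).2.2.1]
    exact (div_pos (hφ0 x) (pow_pos (hξ0 x) 2)).ne'
  have n3 : ∀ x, prolongCoeff ξ φ 3 3 x ≠ 0 := fun x => by
    rw [(prolongCoeff_diag ξ φ x).2.2.2]
    exact (div_pos (hφ0 x) (pow_pos (hξ0 x) 3)).ne'
  let U : E5 → ℝ := fun z => z 1 / prolongCoeff ξ φ 0 0 (η (z 0))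
  let P : E5 → ℝ := fun z => (z 2 - prolongCoeff ξ φ 1 0 (η (z 0)) * U z) /
    prolongCoeff ξ φ 1 1 (η (z 0))
  let Q : E5 → ℝ := fun z => (z 3 - prolongCoeff ξ φ 2 0 (η (z 0)) * U z -
    prolongCoeff ξ φ 2 1 (η (z 0)) * P z) / prolongCoeff ξ φ 2 2 (η (z 0))
  let R : E5 → ℝ := fun z => (z 4 - prolongCoeff ξ φ 3 0 (η (z 0)) * U z -
    prolongCoeff ξ φ 3 1 (η (z 0)) * P z - prolongCoeff ξ φ 3 2 (η (z 0)) * Q z) /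
    prolongCoeff ξ φ 3 3 (η (z 0))
  have hU : ContDiff ℝ (⊤ : ℕ∞) U := (hz 1).div (hc 0 0) fun z => n0 _
  have hP : ContDiff ℝ (⊤ : ℕ∞) P := ((hz 2).sub ((hc 1 0).mul hU)).div (hc 1 1) fun z => n1 _
  have hQ : ContDiff ℝ (⊤ : ℕ∞) Q :=
    (((hz 3).sub ((hc 2 0).mul hU)).sub ((hc 2 1).mul hP)).div (hc 2 2) fun z => n2 _
  have hR : ContDiff ℝ (⊤ : ℕ∞) R :=
    ((((hz 4).sub ((hc 3 0).mul hU)).sub ((hc 3 1).mul hP)).sub ((hc 3 2).mul hQ)).div (hc 3 3)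
      fun z => n3 _
  have z01 := prolongCoeff_eq_zero ξ φ 0 1 (by simp)
  have z02 := prolongCoeff_eq_zero ξ φ 0 2 (by simp)
  have z03 := prolongCoeff_eq_zero ξ φ 0 3 (by simp)
  have z12 := prolongCoeff_eq_zero ξ φ 1 2 (by simp)
  have z13 := prolongCoeff_eq_zero ξ φ 1 3 (by simp)
  have z23 := prolongCoeff_eq_zero ξ φ 2 3 (by simp)
  refine ⟨fun z => ![η (z 0), U z, P z, Q z, R z], ?_, fun z => ?_, fun z => ?_⟩
  · refine contDiff_pi.2 fun i => ?_
    fin_cases i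
    · exact hη.comp (hz 0)
    · exact hU
    · exact hP
    · exact hQ
    · exact hR
  · have e0 : η (prolong ξ φ z 0) = z 0 := h1 _
    have e1 : U (prolong ξ φ z) = z 1 := by
      simp only [U, e0]
      simp only [prolong, jetForm, Matrix.cons_val, z01, z02, z03, Pi.zero_apply]
      field_simp [n0 (z 0)]
      ring
    have e2 : P (prolong ξ φ z) = z 2 := by
      simp only [P, e0, e1]
      simp only [prolong, jetForm, Matrix.cons_val, z12, z13, Pi.zero_apply]
      field_simp [n1 (z 0)]
      ring
    have e3 : Q (prolong ξ φ z) = z 3 := by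
      simp only [Q, e0, e1, e2]
      simp only [prolong, jetForm, Matrix.cons_val, z23, Pi.zero_apply]
      field_simp [n2 (z 0)]
      ring
    have e4 : R (prolong ξ φ z) = z 4 := by
      simp only [R, e0, e1, e2, e3]
      simp only [prolong, jetForm, Matrix.cons_val]
      field_simp [n3 (z 0)]
      ring
    ext i
    fin_cases i
    · exact e0
    · exact e1
    · exact e2
    · exact e3
    · exact e4
  · have e1 : prolongCoeff ξ φ 0 0 (η (z 0)) * U z = z 1 := mul_div_cancel₀ _ (n0 _)
    have e2 := mul_div_cancel₀ (z 2 - prolongCoeff ξ φ 1 0 (η (z 0)) * U z) (n1 (η (z 0)))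
    have e3 := mul_div_cancel₀ (z 3 - prolongCoeff ξ φ 2 0 (η (z 0)) * U z -
      prolongCoeff ξ φ 2 1 (η (z 0)) * P z) (n2 (η (z 0)))
    have e4 := mul_div_cancel₀ (z 4 - prolongCoeff ξ φ 3 0 (η (z 0)) * U z -
      prolongCoeff ξ φ 3 1 (η (z 0)) * P z - prolongCoeff ξ φ 3 2 (η (z 0)) * Q z) (n3 (η (z 0)))
    change prolongCoeff ξ φ 1 1 (η (z 0)) * P z = _ at e2
    change prolongCoeff ξ φ 2 2 (η (z 0)) * Q z = _ at e3
    change prolongCoeff ξ φ 3 3 (η (z 0)) * R z = _ at e4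
    ext i
    fin_cases i
    · exact h2 _
    all_goals
      simp [prolong, jetForm, z01, z02, z03, z12, z13, z23]
      linarith

theorem ω1_apply (z v : E5) : ω1 z v = v 0 := rfl

theorem ω2_apply (z v : E5) : ω2 z v = (z 1)⁻¹ * (v 1 - z 2 * v 0) := rfl

theorem ω3_apply (z v : E5) : ω3 z v = v 2 - z 3 * v 0 := rfl

theorem ω4_apply (z v : E5) : ω4 z v = v 3 - z 4 * v 0 := rfl

/-- A map that pulls `ω¹, …, ω⁴` back as prescribed by the structure group is the prolongation
of a fiber-preserving linear transformation `(x, u) ↦ (ξ(x), φ(x) u)`. -/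
theorem exists_eq_prolong {s : Set E5} (hs : s = {z | 0 < z 1}) {Φ : E5 → E5}
    {a1 a2 a3 a4 a5 a6 : E5 → ℝ} (hΦ : ContDiffOn ℝ (⊤ : ℕ∞) Φ s)
    (hpos : ∀ z ∈ s, 0 < Φ z 1) (ha : ∀ z ∈ s, a1 z ≠ 0)
    (h1 : ∀ z ∈ s, ∀ v, ω1 (Φ z) (fderiv ℝ Φ z v) = a1 z * ω1 z v)
    (h2 : ∀ z ∈ s, ∀ v, ω2 (Φ z) (fderiv ℝ Φ z v) = ω2 z v)
    (h3 : ∀ z ∈ s, ∀ v, ω3 (Φ z) (fderiv ℝ Φ z v) = a2 z * ω2 z v + a3 z * ω3 z v)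
    (h4 : ∀ z ∈ s, ∀ v,
      ω4 (Φ z) (fderiv ℝ Φ z v) = a4 z * ω2 z v + a5 z * ω3 z v + a6 z * ω4 z v) :
    ∃ ξ φ : ℝ → ℝ, ContDiff ℝ (⊤ : ℕ∞) ξ ∧ ContDiff ℝ (⊤ : ℕ∞) φ ∧ (∀ x, deriv ξ x ≠ 0) ∧
      (∀ x, 0 < φ x) ∧ ∀ z ∈ s, Φ z = prolong ξ φ z := by
  have hso : IsOpen s := hs ▸ isOpen_lt continuous_const (continuous_apply 1)
  have hsc : Convex ℝ s := hs ▸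
    convex_halfSpace_gt (LinearMap.proj (R := ℝ) (φ := fun _ : Fin 5 => ℝ) 1).isLinear 0
  have mem : ∀ z, z ∈ s ↔ 0 < z 1 := fun z => by rw [hs]; rfl
  simp only [ω1_apply, ω2_apply, ω3_apply, ω4_apply] at h1 h2 h3 h4
  have hd : ∀ z ∈ s, HasFDerivAt Φ (fderiv ℝ Φ z) z := fun z hz =>
    ((hΦ.contDiffAt (hso.mem_nhds hz)).differentiableAt (by simp)).hasFDerivAt
  have hdi : ∀ i, ∀ z ∈ s, HasFDerivAt (fun z => Φ z i)
      ((ContinuousLinearMap.proj i : E5 →L[ℝ] ℝ).comp (fderiv ℝ Φ z)) z :=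
    fun i z hz => (hasFDerivAt_pi'.1 (hd z hz)) i
  have transfer : ∀ (i : Fin 5) (F : E5 → ℝ) (F' : E5 → E5 →L[ℝ] ℝ), (∀ z ∈ s, Φ z i = F z) →
      (∀ z, HasFDerivAt F (F' z) z) → ∀ z ∈ s, ∀ v, fderiv ℝ Φ z v i = F' z v := by
    intro i F F' hF hF' z hz v
    have h := (hF' z).congr_of_eventuallyEq (Filter.eventually_of_mem (hso.mem_nhds hz) hF)
    exact DFunLike.congr_fun ((hdi i z hz).unique h) v
  let e : ℝ → E5 := fun x => ![x, 1, 0, 0, 0]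
  have he : ContDiff ℝ (⊤ : ℕ∞) e := by
    refine contDiff_pi.2 fun i => ?_
    fin_cases i
    · exact contDiff_id
    all_goals exact contDiff_const
  have hes : ∀ x, e x ∈ s := fun x => (mem _).2 (by simp [e])
  have he0 : ∀ z : E5, (z - e (z 0)) 0 = 0 := fun z => sub_self (z 0)
  have hΦe : ContDiff ℝ (⊤ : ℕ∞) (fun x => Φ (e x)) := hΦ.comp_contDiff he hes
  let ξ : ℝ → ℝ := fun x => Φ (e x) 0
  let φ : ℝ → ℝ := fun x => Φ (e x) 1
  have hξ : ContDiff ℝ (⊤ : ℕ∞) ξ := contDiff_pi.1 hΦe 0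
  have hφ : ContDiff ℝ (⊤ : ℕ∞) φ := contDiff_pi.1 hΦe 1
  have c0 : ∀ z ∈ s, Φ z 0 = ξ (z 0) := fun z hz =>
    eq_of_hasFDerivAt_apply_sub_eq_zero hsc (hdi 0) (hes (z 0)) hz fun y hy => by
      change fderiv ℝ Φ y (z - e (z 0)) 0 = 0
      rw [h1 y hy, he0, mul_zero]
  have d0 : ∀ z ∈ s, ∀ v, fderiv ℝ Φ z v 0 = deriv ξ (z 0) * v 0 :=
    transfer 0 (fun z => ξ (z 0)) (fun z => deriv ξ (z 0) • dX) c0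
      (hasFDerivAt_comp_apply_zero hξ.differentiable_infty)
  have hξ0 : ∀ x, deriv ξ x ≠ 0 := fun x => by
    have h := d0 _ (hes x) (e 1)
    rw [h1 _ (hes x)] at h
    have h' : a1 (e x) = deriv ξ x := by simpa [e] using h
    exact h' ▸ ha _ (hes x)
  have hk := fun n i => (contDiff_prolongCoeff hξ hξ0 hφ n i).differentiable_infty
  have c1 : ∀ z ∈ s, Φ z 1 = jetForm (prolongCoeff ξ φ 0) z := by
    intro z hz
    have hF : ∀ y ∈ s, HasFDerivAt (fun y => Φ y 1 * (y 1)⁻¹) _ y := fun y hy =>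
      (hdi 1 y hy).mul ((hasDerivAt_inv ((mem y).1 hy).ne').comp_hasFDerivAt y
        (hasFDerivAt_apply (𝕜 := ℝ) (1 : Fin 5) y))
    have h := eq_of_hasFDerivAt_apply_sub_eq_zero hsc hF (hes (z 0)) hz fun y hy => by
      have hy0 := ((mem y).1 hy).ne'
      have hp0 := (hpos y hy).ne'
      have h5 := h2 y hy (z - e (z 0))
      rw [h1 y hy] at h5
      rw [he0] at h5
      simp only [mul_zero, sub_zero] at h5
      have h7 : fderiv ℝ Φ y (z - e (z 0)) 1 = Φ y 1 * ((y 1)⁻¹ * (z - e (z 0)) 1) := by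
        rw [← h5, mul_inv_cancel_left₀ hp0]
      change Φ y 1 * (-(y 1 ^ 2)⁻¹ * (z - e (z 0)) 1) +
        (y 1)⁻¹ * fderiv ℝ Φ y (z - e (z 0)) 1 = 0
      rw [h7]
      field_simp
      ring
    have hz0 := ((mem z).1 hz).ne'
    have h' : Φ z 1 * (z 1)⁻¹ = φ (z 0) := by simpa [e, φ] using h
    rw [← div_eq_mul_inv, div_eq_iff hz0] at h'
    simp [h', jetForm, prolongCoeff]
  have next : ∀ (n : ℕ) (i j : Fin 5), n < 3 →
      (∀ z ∈ s, Φ z i = jetForm (prolongCoeff ξ φ n) z) →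
      (∀ z ∈ s, fderiv ℝ Φ z ![1, z 2, z 3, z 4, 0] i -
        Φ z j * fderiv ℝ Φ z ![1, z 2, z 3, z 4, 0] 0 = 0) →
      ∀ z ∈ s, Φ z j = jetForm (prolongCoeff ξ φ (n + 1)) z := by
    intro n i j hn hi hT z hz
    have h := hT z hz
    rw [transfer i _ _ hi (hasFDerivAt_jetForm (hk n)) z hz,
      jetFormD_total (prolongCoeff_eq_zero ξ φ n 3 (by simpa)) z (hξ0 _), d0 z hz] at h
    refine mul_right_cancel₀ (hξ0 (z 0)) ?_
    simp only [Matrix.cons_val, mul_one] at h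
    exact (sub_eq_zero.1 h).symm
  have c2 := next 0 1 2 (by simp) c1 fun z hz => by
    have h := h2 z hz ![1, z 2, z 3, z 4, 0]
    simpa [(hpos z hz).ne'] using h
  have c3 := next 1 2 3 (by simp) c2 fun z hz => by
    rw [h3 z hz]
    simp
  have c4 := next 2 3 4 (by simp) c3 fun z hz => by
    rw [h4 z hz]
    simp
  refine ⟨ξ, φ, hξ, hφ, hξ0, fun x => hpos _ (hes x), fun z hz => ?_⟩
  ext i
  fin_cases i
  · exact c0 z hz
  · exact c1 z hz
  · exact c2 z hz
  · exact c3 z hz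
  · exact c4 z hz

/-- If a prolongation matches the differentials of `jetForm g` and `jetForm f` where `u > 0`, then it
pulls `jetForm g` back to `jetForm f`: the two can only differ by a constant, and both are linear in
`(u, p, q, r)`. -/
theorem pullCoeff_eq_of_jetFormD_eq {s : Set E5} (hs : s = {z | 0 < z 1}) {Φ : E5 → E5}
    {f g : Fin 4 → ℝ → ℝ} {ξ φ : ℝ → ℝ} (hΦ : ∀ z ∈ s, DifferentiableAt ℝ Φ z)
    (hf : ∀ i, Differentiable ℝ (f i)) (hg : ∀ i, Differentiable ℝ (g i))
    (hpr : ∀ z ∈ s, Φ z = prolong ξ φ z)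
    (h5 : ∀ z ∈ s, ∀ v, jetFormD g (Φ z) (fderiv ℝ Φ z v) = jetFormD f z v) :
    pullCoeff ξ φ g = f := by
  have hsc : Convex ℝ s := hs ▸
    convex_halfSpace_gt (LinearMap.proj (R := ℝ) (φ := fun _ : Fin 5 => ℝ) 1).isLinear 0
  have mem : ∀ z, z ∈ s ↔ 0 < z 1 := fun z => by rw [hs]; rfl
  have hH : ∀ z ∈ s, HasFDerivAt (fun z => jetForm g (Φ z) - jetForm f z)
      ((jetFormD g (Φ z)).comp (fderiv ℝ Φ z) - jetFormD f z) z := fun z hz =>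
    ((hasFDerivAt_jetForm hg (Φ z)).comp z (hΦ z hz).hasFDerivAt).sub (hasFDerivAt_jetForm hf z)
  refine coeff_eq_of_jetForm_eq fun z hz => ?_
  have hzs := (mem z).2 hz
  have hzs' : ![z 0, 2 * z 1, 2 * z 2, 2 * z 3, 2 * z 4] ∈ s := (mem _).2 (by simpa)
  have h := eq_of_hasFDerivAt_apply_sub_eq_zero hsc hH hzs hzs' fun y hy => by
    simp [h5 y hy]
  rw [hpr _ hzs, hpr _ hzs', jetForm_prolong, jetForm_prolong] at h
  simp only [jetForm, Matrix.cons_val] at h ⊢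
  linarith

/-- Two third-order operators with positive leading coefficient are
directly equivalent under a fiber-preserving transformation `x̄ = ξ(x)`, `ū = φ(x)u`
iff there is a diffeomorphism `Φ : Ω → Ω̄` matching the coframes up to the structure
group `G`. -/
theorem direct_equivalence_iff_coframe_equivalence
    (f0 f1 f2 f3 g0 g1 g2 g3 : ℝ → ℝ)
    (hf0 : ContDiff ℝ (⊤ : ℕ∞) f0) (hf1 : ContDiff ℝ (⊤ : ℕ∞) f1)
    (hf2 : ContDiff ℝ (⊤ : ℕ∞) f2) (hf3 : ContDiff ℝ (⊤ : ℕ∞) f3)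
    (hg0 : ContDiff ℝ (⊤ : ℕ∞) g0) (hg1 : ContDiff ℝ (⊤ : ℕ∞) g1)
    (hg2 : ContDiff ℝ (⊤ : ℕ∞) g2) (hg3 : ContDiff ℝ (⊤ : ℕ∞) g3)
    (hf3pos : ∀ x, 0 < f3 x) (hg3pos : ∀ x, 0 < g3 x) :
    (∃ ξ φ : ℝ → ℝ, ContDiff ℝ (⊤ : ℕ∞) ξ ∧ ContDiff ℝ (⊤ : ℕ∞) φ ∧
      Function.Bijective ξ ∧ (∀ x, 0 < deriv ξ x) ∧ (∀ x, 0 < φ x) ∧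
      ∀ v : ℝ → ℝ, ContDiff ℝ (⊤ : ℕ∞) v → ∀ x : ℝ,
        g3 (ξ x) * iteratedDeriv 3 v (ξ x) + g2 (ξ x) * iteratedDeriv 2 v (ξ x) +
            g1 (ξ x) * deriv v (ξ x) + g0 (ξ x) * v (ξ x) =
          f3 x * iteratedDeriv 3 (fun t => v (ξ t) / φ t) x +
            f2 x * iteratedDeriv 2 (fun t => v (ξ t) / φ t) x +
            f1 x * deriv (fun t => v (ξ t) / φ t) x + f0 x * (v (ξ x) / φ x)) ↔
    (∃ Φ Ψ : E5 → E5, ∃ a1 a2 a3 a4 a5 a6 : E5 → ℝ,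
      ContDiffOn ℝ (⊤ : ℕ∞) Φ (Omega f3) ∧ ContDiffOn ℝ (⊤ : ℕ∞) Ψ (Omega g3) ∧
      MapsTo Φ (Omega f3) (Omega g3) ∧ MapsTo Ψ (Omega g3) (Omega f3) ∧
      (∀ z ∈ Omega f3, Ψ (Φ z) = z) ∧ (∀ z ∈ Omega g3, Φ (Ψ z) = z) ∧
      ContDiffOn ℝ (⊤ : ℕ∞) a1 (Omega f3) ∧ ContDiffOn ℝ (⊤ : ℕ∞) a2 (Omega f3) ∧
      ContDiffOn ℝ (⊤ : ℕ∞) a3 (Omega f3) ∧ ContDiffOn ℝ (⊤ : ℕ∞) a4 (Omega f3) ∧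
      ContDiffOn ℝ (⊤ : ℕ∞) a5 (Omega f3) ∧ ContDiffOn ℝ (⊤ : ℕ∞) a6 (Omega f3) ∧
      (∀ z ∈ Omega f3, a1 z * a3 z * a6 z ≠ 0) ∧
      (∀ z ∈ Omega f3, ∀ v : E5,
        ω1 (Φ z) (fderiv ℝ Φ z v) = a1 z * ω1 z v ∧
        ω2 (Φ z) (fderiv ℝ Φ z v) = ω2 z v ∧
        ω3 (Φ z) (fderiv ℝ Φ z v) = a2 z * ω2 z v + a3 z * ω3 z v ∧
        ω4 (Φ z) (fderiv ℝ Φ z v) = a4 z * ω2 z v + a5 z * ω3 z v + a6 z * ω4 z v ∧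
        ω5d g0 g1 g2 g3 (Φ z) (fderiv ℝ Φ z v) = ω5d f0 f1 f2 f3 z v)) := by
  set f : Fin 4 → ℝ → ℝ := ![f0, f1, f2, f3] with hf_def
  set g : Fin 4 → ℝ → ℝ := ![g0, g1, g2, g3] with hg_def
  have hf : ∀ i, Differentiable ℝ (f i) := fun i => by
    fin_cases i
    exacts [hf0.differentiable_infty, hf1.differentiable_infty, hf2.differentiable_infty,
      hf3.differentiable_infty]
  have hg : ∀ i, Differentiable ℝ (g i) := fun i => by
    fin_cases i
    exacts [hg0.differentiable_infty, hg1.differentiable_infty, hg2.differentiable_infty,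
      hg3.differentiable_infty]
  have operator : ∀ (c0 c1 c2 c3 w : ℝ → ℝ) (x : ℝ),
      c3 x * iteratedDeriv 3 w x + c2 x * iteratedDeriv 2 w x + c1 x * deriv w x + c0 x * w x =
        jetForm ![c0, c1, c2, c3] (jet w x) := fun c0 c1 c2 c3 w x => by
    simp only [jetForm, jet, Matrix.cons_val]
    ring
  constructor
  · rintro ⟨ξ, φ, hξ, hφ, hb, hξ0, hφ0, H⟩
    have hξ' : ∀ x, deriv ξ x ≠ 0 := fun x => (hξ0 x).ne'
    have hpull : pullCoeff ξ φ g = f :=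
      (direct_equivalence_iff_pullCoeff f g hξ hb hξ0 hφ hφ0).1 fun v hv x => by
        rw [← operator, ← operator]
        exact H v hv x
    obtain ⟨Ψ, hΨ, hΨl, hΨr⟩ := exists_prolong_inverse hξ hb hξ0 hφ hφ0
    have hc : ∀ n i, ContDiff ℝ (⊤ : ℕ∞) (fun z : E5 => prolongCoeff ξ φ n i (z 0)) := fun n i =>
      (contDiff_prolongCoeff hξ hξ' hφ n i).comp (contDiff_apply ℝ ℝ 0)
    have hu : ContDiff ℝ (⊤ : ℕ∞) (fun z : E5 => z 1) := contDiff_apply ℝ ℝ 1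
    refine ⟨prolong ξ φ, Ψ, fun z => deriv ξ (z 0), fun z => prolongCoeff ξ φ 1 0 (z 0) * z 1,
      fun z => prolongCoeff ξ φ 1 1 (z 0), fun z => prolongCoeff ξ φ 2 0 (z 0) * z 1,
      fun z => prolongCoeff ξ φ 2 1 (z 0), fun z => prolongCoeff ξ φ 2 2 (z 0),
      (contDiff_prolong hξ hξ' hφ).contDiffOn, hΨ.contDiffOn, fun z hz => ?_, fun z hz => ?_,
      fun z _ => hΨl z, fun z _ => hΨr z,
      (hξ.deriv_infty.comp (contDiff_apply ℝ ℝ 0)).contDiffOn, ((hc 1 0).mul hu).contDiffOn,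
      (hc 1 1).contDiffOn, ((hc 2 0).mul hu).contDiffOn, (hc 2 1).contDiffOn, (hc 2 2).contDiffOn,
      fun z _ => ?_, fun z hz v => ?_⟩
    · rw [mem_Omega_iff hg3pos, prolong_one]
      exact mul_pos (hφ0 _) hz.1
    · have h := prolong_one ξ φ (Ψ z)
      rw [hΨr] at h
      rw [mem_Omega_iff hf3pos]
      exact pos_of_mul_pos_right (h ▸ hz.1) (hφ0 _).le
    · obtain ⟨-, e1, e2, -⟩ := prolongCoeff_diag ξ φ (z 0)
      simp only [e1, e2]
      have := hφ0 (z 0)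
      have := hξ0 (z 0)
      positivity
    · have hD := hasFDerivAt_prolong hξ hξ' hφ z
      have hz1 : z 1 ≠ 0 := hz.1.ne'
      have e := fun n (hn : n < 3) =>
        jetFormD_apply (prolongCoeff_eq_zero ξ φ n 3 (by simpa)) z v (hξ' (z 0))
      have e0 := e 0 (by simp)
      have e1 := e 1 (by simp)
      have e2 := e 2 (by simp)
      simp only [prolongCoeff_eq_zero ξ φ 0 1 (by simp), prolongCoeff_eq_zero ξ φ 0 2 (by simp),
        prolongCoeff_eq_zero ξ φ 1 2 (by simp), Pi.zero_apply] at e0 e1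
      have chain := ((hasFDerivAt_jetForm hg _).comp z hD).unique
        ((hasFDerivAt_jetForm hf z).congr_of_eventuallyEq
          (Filter.Eventually.of_forall fun y => by
            rw [Function.comp_apply, jetForm_prolong, hpull]))
      refine ⟨?_, ?_, ?_, ?_, ?_⟩
      · rw [hD.fderiv]
        rfl
      · rw [hD.fderiv, ω2_apply, prolong_one, ω2_apply]
        change _ * (jetFormD (prolongCoeff ξ φ 0) z v -
          jetForm (liftCoeff ξ (prolongCoeff ξ φ 0)) z * (deriv ξ (z 0) * v 0)) = _
        rw [e0, (prolongCoeff_diag ξ φ (z 0)).1]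
        have := (hφ0 (z 0)).ne'
        field_simp
        ring
      · rw [hD.fderiv, ω3_apply, ω2_apply, ω3_apply]
        change jetFormD (prolongCoeff ξ φ 1) z v -
          jetForm (liftCoeff ξ (prolongCoeff ξ φ 1)) z * (deriv ξ (z 0) * v 0) = _
        rw [e1]
        field_simp
        ring
      · rw [hD.fderiv, ω4_apply, ω2_apply, ω3_apply, ω4_apply]
        change jetFormD (prolongCoeff ξ φ 2) z v -
          jetForm (liftCoeff ξ (prolongCoeff ξ φ 2)) z * (deriv ξ (z 0) * v 0) = _
        rw [e2]
        field_simp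
        ring
      · rw [hD.fderiv, ← jetFormD_eq_ω5d, ← jetFormD_eq_ω5d]
        exact DFunLike.congr_fun chain v
  · rintro ⟨Φ, Ψ, a1, a2, a3, a4, a5, a6, hΦ, -, hmaps, hmaps', -, hr, -, -, -, -, -, -, ha, H⟩
    have hs := Omega_eq hf3pos
    obtain ⟨ξ, φ, hξ, hφ, hξ', hφ0, hpr⟩ := exists_eq_prolong hs hΦ (fun z hz => (hmaps hz).1)
      (fun z hz => left_ne_zero_of_mul (left_ne_zero_of_mul (ha z hz)))
      (fun z hz v => (H z hz v).1) (fun z hz v => (H z hz v).2.1)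
      (fun z hz v => (H z hz v).2.2.1) (fun z hz v => (H z hz v).2.2.2.1)
    have hpull : pullCoeff ξ φ g = f := by
      refine pullCoeff_eq_of_jetFormD_eq hs (fun z hz => (hΦ.contDiffAt
        ((isOpen_Omega hf3pos).mem_nhds hz)).differentiableAt (by simp)) hf hg hpr ?_
      intro z hz v
      rw [jetFormD_eq_ω5d, jetFormD_eq_ω5d]
      exact (H z hz v).2.2.2.2
    have hξ0 : ∀ x, 0 < deriv ξ x := fun x => by
      have h : g3 (ξ x) * (φ x / deriv ξ x ^ 3) = f3 x := by
        rw [← show pullCoeff ξ φ g 3 x = f3 x by rw [hpull]; rfl, pullCoeff_three]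
        rfl
      have h1 := pos_of_mul_pos_right (h ▸ hf3pos x) (hg3pos _).le
      exact (Odd.pow_pos_iff (by decide)).1 ((div_pos_iff_of_pos_left (hφ0 x)).1 h1)
    have hb : Function.Bijective ξ := by
      refine ⟨(strictMono_of_deriv_pos hξ0).injective, fun y => ?_⟩
      have hy : (![y, 1, 0, 0, 0] : E5) ∈ Omega g3 := (mem_Omega_iff hg3pos).2 (by simp)
      have h := congrFun (hr _ hy) 0
      rw [hpr _ (hmaps' hy)] at h
      exact ⟨_, h⟩
    refine ⟨ξ, φ, hξ, hφ, hb, hξ0, hφ0, fun v hv x => ?_⟩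
    have h := (direct_equivalence_iff_pullCoeff f g hξ hb hξ0 hφ hφ0).2 hpull v hv x
    rw [← operator, ← operator] at h
    exact h
end
end

section
/- Let f₃ : ℝ → ℝ be smooth, and fix a point (x,u,p,q,r) ∈ ℝ⁵ with u > 0 and f₃(x) > 0. For real numbers a₁, a₂, a₃, a₆ with a₁a₃a₆ ≠ 0, the four normalization conditions −(a₂ + a₃p)/(a₁a₃u) = 0, 1/(a₁a₃u) = 1, a₃/(a₁a₆) = 1, a₆/(a₁f₃(x)) = 1 hold if and only if a₁ = (f₃(x)u)^{−1/3}, a₂ = −(f₃(x)/u²)^{1/3}·p, a₃ = (f₃(x)/u²)^{1/3}, and a₆ = (f₃(x)²/u)^{1/3} (real cube roots). In particular the solution of the normalization equations is unique. -/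
noncomputable section

open Real

/-- The real cube root of a positive number is the positive number whose cube it is. -/
lemma rpow_one_third_of_eq_cube {a b : ℝ} (hb : 0 < b) (h : a = b ^ 3) :
    a ^ ((1 : ℝ) / 3) = b := by
  rw [h, ← Real.rpow_natCast, ← Real.rpow_mul hb.le]
  norm_num

lemma exists_pos_cube_root {a : ℝ} (ha : 0 < a) : ∃ b : ℝ, 0 < b ∧ a = b ^ 3 := by
  refine ⟨a ^ ((1 : ℝ) / 3), Real.rpow_pos_of_pos ha _, ?_⟩
  rw [← Real.rpow_natCast, ← Real.rpow_mul ha.le]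
  norm_num

/-- The Cartan normalization conditions `T²₁₂ = 0`,
`T²₁₃ = T³₁₄ = T⁴₁₅ = 1` on the essential torsion determine the group parameters
uniquely: `a₁ = (f₃u)^{-1/3}`, `a₂ = −(f₃/u²)^{1/3}p`, `a₃ = (f₃/u²)^{1/3}`,
`a₆ = (f₃²/u)^{1/3}`. -/
theorem normalization_unique
    (f3 : ℝ → ℝ) (hf3 : ContDiff ℝ (⊤ : ℕ∞) f3)
    (x u p q r : ℝ) (hu : 0 < u) (hf : 0 < f3 x)
    (a1 a2 a3 a6 : ℝ) (ha : a1 * a3 * a6 ≠ 0) :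
    (-(a2 + a3 * p) / (a1 * a3 * u) = 0 ∧ 1 / (a1 * a3 * u) = 1 ∧
        a3 / (a1 * a6) = 1 ∧ a6 / (a1 * f3 x) = 1) ↔
      (a1 = (f3 x * u) ^ (-(1 : ℝ) / 3) ∧
        a2 = -((f3 x / u ^ 2) ^ ((1 : ℝ) / 3) * p) ∧
        a3 = (f3 x / u ^ 2) ^ ((1 : ℝ) / 3) ∧
        a6 = ((f3 x) ^ 2 / u) ^ ((1 : ℝ) / 3)) := by
  obtain ⟨h13, h6⟩ := mul_ne_zero_iff.mp ha
  obtain ⟨h1, h3⟩ := mul_ne_zero_iff.mp h13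
  generalize f3 x = F at hf ⊢
  obtain ⟨s, hs, rfl⟩ := exists_pos_cube_root hf
  obtain ⟨t, ht, rfl⟩ := exists_pos_cube_root hu
  have e1 : (s ^ 3 * t ^ 3) ^ (-(1 : ℝ) / 3) = 1 / (s * t) := by
    rw [neg_div, Real.rpow_neg (by positivity),
      rpow_one_third_of_eq_cube (mul_pos hs ht) (by ring), one_div]
  have e3 : (s ^ 3 / (t ^ 3) ^ 2) ^ ((1 : ℝ) / 3) = s / t ^ 2 :=
    rpow_one_third_of_eq_cube (by positivity) (by ring)
  have e6 : ((s ^ 3) ^ 2 / t ^ 3) ^ ((1 : ℝ) / 3) = s ^ 2 / t :=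
    rpow_one_third_of_eq_cube (by positivity) (by ring)
  rw [e1, e3, e6]
  have hs0 := hs.ne'
  have ht0 := ht.ne'
  constructor
  · rintro ⟨c2, c13, c14, c15⟩
    have hden : a1 * a3 * t ^ 3 ≠ 0 := by positivity
    have k2 : a2 = -(a3 * p) := by
      have := (div_eq_zero_iff.mp c2).resolve_right hden
      linarith
    have k13 : a1 * a3 * t ^ 3 = 1 := ((div_eq_one_iff_eq hden).mp c13).symm
    have k14 : a3 = a1 * a6 := (div_eq_one_iff_eq (mul_ne_zero h1 h6)).mp c14
    have k15 : a6 = a1 * s ^ 3 := (div_eq_one_iff_eq (by positivity)).mp c15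
    have hcube : (a1 * (s * t)) ^ 3 = 1 ^ 3 := by
      rw [k14, k15] at k13
      linear_combination k13
    have ha1 : a1 = 1 / (s * t) :=
      eq_one_div_of_mul_eq_one_left ((Odd.strictMono_pow (by decide : Odd 3)).injective hcube)
    have ha6 : a6 = s ^ 2 / t := by
      rw [k15, ha1]
      field_simp
    have ha3 : a3 = s / t ^ 2 := by
      rw [k14, ha1, ha6]
      field_simp
    exact ⟨ha1, by rw [k2, ha3], ha3, ha6⟩
  · rintro ⟨rfl, rfl, rfl, rfl⟩
    refine ⟨by simp, ?_, ?_, ?_⟩ <;> field_simp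
end
end

section
/- Let f₀, f₁, f₂, f₃ : ℝ → ℝ be smooth and let Ω = {(x,u,p,q,r) ∈ ℝ⁵ : u > 0, f₃(x) > 0}. Define on Ω the 1-forms θ¹ = (f₃(x)u)^{−1/3} dx, θ² = (du − p dx)/u, θ³ = (f₃(x)/u²)^{1/3}·[ (dp − q dx) − (p/u)(du − p dx) ]. Then the first two structure equations of the direct equivalence problem hold on Ω: dθ¹ = (1/3)·θ¹∧θ² and dθ² = θ¹∧θ³. -/
noncomputable section

open Real Set

/-- The normalized coframe element `θ¹ = (f₃u)^{-1/3} dx` of the direct problem. -/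
def θ1d (f3 : ℝ → ℝ) : E5 → E5 →L[ℝ] ℝ := fun z =>
  ((f3 (z 0) * z 1) ^ (-(1 : ℝ) / 3)) • dX

/-- The normalized coframe element
`θ³ = (f₃/u²)^{1/3}[(dp − qdx) − (p/u)(du − pdx)]` of the direct problem. -/
def θ3d (f3 : ℝ → ℝ) : E5 → E5 →L[ℝ] ℝ := fun z =>
  ((f3 (z 0) / (z 1) ^ 2) ^ ((1 : ℝ) / 3)) •
    ((dP - z 3 • dX) - (z 2 / z 1) • (dU - z 2 • dX))

/-- The normalized group parameter `a₄ = (5f₃p² − f₃'pu − 3f₃qu)/(3(f₃u)^{1/3}u)`. -/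
def a4d (f3 : ℝ → ℝ) : E5 → ℝ := fun z =>
  (5 * f3 (z 0) * (z 2) ^ 2 - deriv f3 (z 0) * z 2 * z 1 - 3 * f3 (z 0) * z 3 * z 1) /
    (3 * (f3 (z 0) * z 1) ^ ((1 : ℝ) / 3) * z 1)

/-- The normalized group parameter `a₅ = (f₃'u − 5f₃p)/(3(f₃u)^{1/3}u)`. -/
def a5d (f3 : ℝ → ℝ) : E5 → ℝ := fun z =>
  (deriv f3 (z 0) * z 1 - 5 * f3 (z 0) * z 2) / (3 * (f3 (z 0) * z 1) ^ ((1 : ℝ) / 3) * z 1)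

/-- The normalized group parameter `a₆ = (f₃²/u)^{1/3}`. -/
def a6d (f3 : ℝ → ℝ) : E5 → ℝ := fun z => ((f3 (z 0)) ^ 2 / z 1) ^ ((1 : ℝ) / 3)

/-- The normalized coframe element `θ⁴ = a₄ω² + a₅ω³ + a₆ω⁴` of the direct problem. -/
def θ4d (f3 : ℝ → ℝ) : E5 → E5 →L[ℝ] ℝ := fun z =>
  a4d f3 z • ω2 z + a5d f3 z • ω3 z + a6d f3 z • ω4 z

theorem extD_eq_of_hasFDerivAt {θ : E5 → E5 →L[ℝ] ℝ} {θ' : E5 →L[ℝ] E5 →L[ℝ] ℝ} {z : E5}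
    (h : HasFDerivAt θ θ' z) (v w : E5) : extD θ z v w = θ' v w - θ' w v := by
  rw [extD, h.fderiv]

theorem hasFDerivAt_coord (i : Fin 5) (z : E5) :
    HasFDerivAt (fun y : E5 => y i) (ContinuousLinearMap.proj i : E5 →L[ℝ] ℝ) z :=
  (ContinuousLinearMap.proj i : E5 →L[ℝ] ℝ).hasFDerivAt

theorem extD_θ1d {f3 : ℝ → ℝ} {z : E5} (hf : DifferentiableAt ℝ f3 (z 0)) (hz : z ∈ Omega f3)
    (v w : E5) : extD (θ1d f3) z v w = (1 / 3) * wedge (θ1d f3) ω2 z v w := by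
  obtain ⟨hu, hf3⟩ := hz
  have hmul : 0 < f3 (z 0) * z 1 := mul_pos hf3 hu
  have hcoeff := ((hf.hasDerivAt.comp_hasFDerivAt z (hasFDerivAt_coord 0 z)).mul
    (hasFDerivAt_coord 1 z)).rpow_const (p := -(1 : ℝ) / 3) (Or.inl hmul.ne')
  have hθ : HasFDerivAt (θ1d f3) _ z := hcoeff.smul_const dX
  rw [extD_eq_of_hasFDerivAt hθ]
  have hpow : (f3 (z 0) * z 1) ^ (-(1 : ℝ) / 3 - 1) =
      (f3 (z 0) * z 1) ^ (-(1 : ℝ) / 3) / (f3 (z 0) * z 1) := Real.rpow_sub_one hmul.ne' _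
  simp [wedge, θ1d, ω2, dX, dU, hpow]
  field_simp
  ring

theorem θ1d_coeff_mul_θ3d_coeff {a u : ℝ} (ha : 0 < a) (hu : 0 < u) :
    (a * u) ^ (-(1 : ℝ) / 3) * (a / u ^ 2) ^ ((1 : ℝ) / 3) = u⁻¹ := by
  have hquot : a / u ^ 2 = (a * u) * (u⁻¹) ^ 3 := by field_simp
  rw [hquot, Real.mul_rpow (x := a * u) (by positivity) (by positivity), ← mul_assoc,
    ← Real.rpow_add (by positivity), ← Real.rpow_natCast, ← Real.rpow_mul (by positivity)]
  norm_num

theorem extD_ω2 {z : E5} (hu : z 1 ≠ 0) (v w : E5) :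
    extD ω2 z v w = (z 1)⁻¹ * (v 0 * (w 2 - z 2 / z 1 * w 1) - w 0 * (v 2 - z 2 / z 1 * v 1)) := by
  have hinv := (hasDerivAt_inv hu).comp_hasFDerivAt z (hasFDerivAt_coord 1 z)
  have hω : HasFDerivAt ω2 _ z :=
    hinv.smul (((hasFDerivAt_coord 2 z).smul_const dX).const_sub dU)
  rw [extD_eq_of_hasFDerivAt hω]
  simp [dX, dU]
  field_simp
  ring

theorem wedge_θ1d_θ3d {f3 : ℝ → ℝ} {z : E5} (hz : z ∈ Omega f3) (v w : E5) :
    wedge (θ1d f3) (θ3d f3) z v w =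
      (z 1)⁻¹ * (v 0 * (w 2 - z 2 / z 1 * w 1) - w 0 * (v 2 - z 2 / z 1 * v 1)) := by
  rw [← θ1d_coeff_mul_θ3d_coeff hz.2 hz.1]
  simp only [wedge, θ1d, θ3d, dX, dU, dP, smul_apply,
    sub_apply, ContinuousLinearMap.proj_apply, smul_eq_mul]
  ring

/-- The first two structure equations of the direct equivalence
problem: `dθ¹ = (1/3)θ¹∧θ²` and `dθ² = θ¹∧θ³` on `Ω`. -/
theorem direct_structure_eqs_one_two
    (f0 f1 f2 f3 : ℝ → ℝ)
    (hf0 : ContDiff ℝ (⊤ : ℕ∞) f0) (hf1 : ContDiff ℝ (⊤ : ℕ∞) f1)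
    (hf2 : ContDiff ℝ (⊤ : ℕ∞) f2) (hf3 : ContDiff ℝ (⊤ : ℕ∞) f3) :
    ∀ z ∈ Omega f3, ∀ v w : E5,
      extD (θ1d f3) z v w = (1 / 3) * wedge (θ1d f3) ω2 z v w ∧
      extD ω2 z v w = wedge (θ1d f3) (θ3d f3) z v w := by
  intro z hz v w
  exact ⟨extD_θ1d (hf3.differentiable (by simp) _) hz v w,
    (extD_ω2 hz.1.ne' v w).trans (wedge_θ1d_θ3d hz v w).symm⟩
end
end

section
/- Let f₀, f₁, f₂, f₃ : ℝ → ℝ be smooth and let Ω = {(x,u,p,q,r) ∈ ℝ⁵ : u > 0, f₃(x) > 0}. With θ¹ = (f₃u)^{−1/3}dx, θ² = (du − p dx)/u, θ³ = (f₃/u²)^{1/3}[(dp − q dx) − (p/u)(du − p dx)], and the base forms ω² = (du − p dx)/u, ω³ = dp − q dx, ω⁴ = dq − r dx, define θ⁴ = a₄ω² + a₅ω³ + a₆ω⁴ where a₄ = (5f₃p² − f₃'pu − 3f₃qu)/(3(f₃u)^{1/3}u), a₅ = (f₃'u − 5f₃p)/(3(f₃u)^{1/3}u), a₆ = (f₃²/u)^{1/3}.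 Then the third structure equation dθ³ = θ¹∧θ⁴ + (1/3)·θ²∧θ³ holds on Ω; moreover θ⁴ is the UNIQUE 1-form of the shape b₄ω² + b₅ω³ + b₆ω⁴ (with continuous functions b₄, b₅, b₆ on Ω) satisfying this equation. -/
noncomputable section

open Real Set

/-- The conformal factor of `θ³` has logarithmic differential
`f₃'/(3f₃) dx − 2/(3u) du`. -/
lemma hasFDerivAt_theta3_factor {f3 : ℝ → ℝ} {z : E5} (hf : DifferentiableAt ℝ f3 (z 0))
    (hu : 0 < z 1) (hF : 0 < f3 (z 0)) :
    HasFDerivAt (fun y : E5 => (f3 (y 0) / (y 1) ^ 2) ^ ((1 : ℝ) / 3))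
      ((f3 (z 0) / (z 1) ^ 2) ^ ((1 : ℝ) / 3) •
        ((deriv f3 (z 0) / (3 * f3 (z 0))) • dX - (2 / (3 * z 1)) • dU)) z := by
  have hx : HasFDerivAt (fun y : E5 => y 0) dX z := dX.hasFDerivAt
  have hU : HasFDerivAt (fun y : E5 => y 1) dU z := dU.hasFDerivAt
  have hg : 0 < f3 (z 0) / (z 1) ^ 2 := by positivity
  have hfx : HasFDerivAt (fun y : E5 => f3 (y 0)) (deriv f3 (z 0) • dX) z :=
    hf.hasDerivAt.comp_hasFDerivAt z hx
  have hquot : HasFDerivAt (fun y : E5 => f3 (y 0) / (y 1) ^ 2) _ z :=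
    hfx.mul ((hasDerivAt_inv (pow_ne_zero 2 hu.ne')).comp_hasFDerivAt z (hU.pow 2))
  have h := hquot.rpow_const (p := (1 : ℝ) / 3) (Or.inl hg.ne')
  refine h.congr_fderiv ?_
  rw [Real.rpow_sub_one hg.ne']
  ext v
  simp
  field_simp
  ring

/-- The exterior derivative of `θ³`, written in the coordinates of the two arguments. -/
lemma extD_theta3 {f3 : ℝ → ℝ} {z : E5} (hf : DifferentiableAt ℝ f3 (z 0))
    (hu : 0 < z 1) (hF : 0 < f3 (z 0)) (v w : E5) :
    extD (θ3d f3) z v w = (f3 (z 0) / (z 1) ^ 2) ^ ((1 : ℝ) / 3) *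
      ((deriv f3 (z 0) / (3 * f3 (z 0)) - 2 * z 2 / z 1) * (v 0 * w 2 - w 0 * v 2)
        + (5 * z 2 ^ 2 / (3 * z 1 ^ 2) - deriv f3 (z 0) * z 2 / (3 * f3 (z 0) * z 1)
            - 2 * z 3 / (3 * z 1)) * (v 0 * w 1 - w 0 * v 1)
        + (v 0 * w 3 - w 0 * v 3)
        + 1 / (3 * z 1) * (v 1 * w 2 - w 1 * v 2)) := by
  have hU : HasFDerivAt (fun y : E5 => y 1) dU z := dU.hasFDerivAt
  have hP : HasFDerivAt (fun y : E5 => y 2) dP z := dP.hasFDerivAt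
  have hQ : HasFDerivAt (fun y : E5 => y 3) dQ z := dQ.hasFDerivAt
  have h : HasFDerivAt (θ3d f3) _ z :=
    (hasFDerivAt_theta3_factor hf hu hF).fun_smul
      (((hasFDerivAt_const dP z).fun_sub (hQ.smul_const dX)).fun_sub
        ((hP.mul ((hasDerivAt_inv hu.ne').comp_hasFDerivAt z hU)).fun_smul ((hasFDerivAt_const dU z).fun_sub (hP.smul_const dX))))
  rw [extD, h.fderiv]
  simp [dX, dU, dP, dQ]
  field_simp
  ring

/-- Wedging with `θ¹` is injective on forms spanned by `ω²`, `ω³`, `ω⁴`. -/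
lemma coeff_eq_of_wedge_theta1_eq {f3 : ℝ → ℝ} {z : E5} (hz : z ∈ Omega f3)
    {a4 a5 a6 b4 b5 b6 : E5 → ℝ}
    (h : ∀ v w : E5,
      wedge (θ1d f3) (fun y => b4 y • ω2 y + b5 y • ω3 y + b6 y • ω4 y) z v w =
        wedge (θ1d f3) (fun y => a4 y • ω2 y + a5 y • ω3 y + a6 y • ω4 y) z v w) :
    b4 z = a4 z ∧ b5 z = a5 z ∧ b6 z = a6 z := by
  have hu : z 1 ≠ 0 := hz.1.ne'
  have hc : (f3 (z 0) * z 1) ^ (-(1 : ℝ) / 3) ≠ 0 :=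
    (Real.rpow_pos_of_pos (mul_pos hz.2 hz.1) _).ne'
  refine ⟨?_, ?_, ?_⟩
  · simpa [wedge, θ1d, ω2, ω3, ω4, dX, dU, dP, dQ, hc, hu] using h (Pi.single 0 1) (Pi.single 1 1)
  · simpa [wedge, θ1d, ω2, ω3, ω4, dX, dU, dP, dQ, hc, hu] using h (Pi.single 0 1) (Pi.single 2 1)
  · simpa [wedge, θ1d, ω2, ω3, ω4, dX, dU, dP, dQ, hc, hu] using h (Pi.single 0 1) (Pi.single 3 1)

/-- The structure equation `dθ³ = θ¹∧θ⁴ + (1/3)θ²∧θ³` at a point of `Ω`. -/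
lemma extD_theta3_eq_wedge {f3 : ℝ → ℝ} {z : E5} (hf : DifferentiableAt ℝ f3 (z 0))
    (hz : z ∈ Omega f3) (v w : E5) :
    extD (θ3d f3) z v w =
      wedge (θ1d f3) (θ4d f3) z v w + (1 / 3) * wedge ω2 (θ3d f3) z v w := by
  obtain ⟨hu, hF⟩ := hz
  rw [extD_theta3 hf hu hF]
  obtain ⟨s, hs, hs3⟩ : ∃ s : ℝ, 0 < s ∧ s ^ 3 = f3 (z 0) :=
    ⟨f3 (z 0) ^ ((1 : ℝ) / 3), by positivity, by rw [← Real.rpow_mul_natCast hF.le]; norm_num⟩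
  obtain ⟨t, ht, ht3⟩ : ∃ t : ℝ, 0 < t ∧ t ^ 3 = z 1 :=
    ⟨z 1 ^ ((1 : ℝ) / 3), by positivity, by rw [← Real.rpow_mul_natCast hu.le]; norm_num⟩
  have cbrt {y : ℝ} (hy : 0 < y) : (y ^ 3) ^ ((1 : ℝ) / 3) = y := by
    rw [← Real.rpow_natCast_mul hy.le]; norm_num
  have h1 : (f3 (z 0) / z 1 ^ 2) ^ ((1 : ℝ) / 3) = s / t ^ 2 := by
    rw [← cbrt (y := s / t ^ 2) (by positivity), ← hs3, ← ht3]; congr 1; ring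
  have h2 : (f3 (z 0) * z 1) ^ ((1 : ℝ) / 3) = s * t := by
    rw [← cbrt (y := s * t) (by positivity), ← hs3, ← ht3]; congr 1; ring
  have h3 : (f3 (z 0) ^ 2 / z 1) ^ ((1 : ℝ) / 3) = s ^ 2 / t := by
    rw [← cbrt (y := s ^ 2 / t) (by positivity), ← hs3, ← ht3]; congr 1; ring
  have h4 : (f3 (z 0) * z 1) ^ (-(1 : ℝ) / 3) = (s * t)⁻¹ := by
    rw [neg_div, Real.rpow_neg (mul_pos hF hu).le, h2]
  simp only [wedge, θ1d, θ4d, θ3d, a4d, a5d, a6d, ω2, ω3, ω4, h1, h2, h3, h4]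
  simp [dX, dU, dP, dQ]
  rw [← hs3, ← ht3]
  field_simp
  ring

/-- The third structure equation `dθ³ = θ¹∧θ⁴ + (1/3)θ²∧θ³` of the
direct equivalence problem holds with `θ⁴ = a₄ω² + a₅ω³ + a₆ω⁴` for the normalized
parameters `a₄, a₅, a₆`; moreover `θ⁴` is the unique 1-form of this shape (with
continuous coefficients) satisfying the equation. -/
theorem direct_structure_eq_three_and_uniqueness
    (f0 f1 f2 f3 : ℝ → ℝ)
    (hf0 : ContDiff ℝ (⊤ : ℕ∞) f0) (hf1 : ContDiff ℝ (⊤ : ℕ∞) f1)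
    (hf2 : ContDiff ℝ (⊤ : ℕ∞) f2) (hf3 : ContDiff ℝ (⊤ : ℕ∞) f3) :
    (∀ z ∈ Omega f3, ∀ v w : E5,
        extD (θ3d f3) z v w =
          wedge (θ1d f3) (θ4d f3) z v w + (1 / 3) * wedge ω2 (θ3d f3) z v w) ∧
      ∀ b4 b5 b6 : E5 → ℝ,
        ContinuousOn b4 (Omega f3) → ContinuousOn b5 (Omega f3) →
        ContinuousOn b6 (Omega f3) →
        (∀ z ∈ Omega f3, ∀ v w : E5,
          extD (θ3d f3) z v w =
            wedge (θ1d f3) (fun z' => b4 z' • ω2 z' + b5 z' • ω3 z' + b6 z' • ω4 z') z v w +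
              (1 / 3) * wedge ω2 (θ3d f3) z v w) →
        ∀ z ∈ Omega f3, b4 z = a4d f3 z ∧ b5 z = a5d f3 z ∧ b6 z = a6d f3 z := by
  have hf : Differentiable ℝ f3 := hf3.differentiable (by simp)
  refine ⟨fun z hz => extD_theta3_eq_wedge (hf _) hz, ?_⟩
  intro b4 b5 b6 _ _ _ h z hz
  refine coeff_eq_of_wedge_theta1_eq hz fun v w => ?_
  have := (h z hz v w).symm.trans (extD_theta3_eq_wedge (hf _) hz v w)
  exact add_right_cancel this
end
end

section
/- Let f₀, f₁, f₂, f₃ : ℝ → ℝ be smooth and let Ω = {(x,u,p,q,r) ∈ ℝ⁵ : u > 0, f₃(x) > 0}. Let θ¹, θ², θ³, θ⁴, θ⁵ be the invariant coframe of the direct equivalence problem: θ¹ = (f₃u)^{−1/3}dx, θ² = (du − p dx)/u, θ³ = (f₃/u²)^{1/3}[(dp − q dx) − (p/u)(du − p dx)], θ⁴ = a₄(du − p dx)/u + a₅(dp − q dx) + (f₃²/u)^{1/3}(dq − r dx) with a₄ = (5f₃p² − f₃'pu − 3f₃qu)/(3(f₃u)^{1/3}u), a₅ = (f₃'u − 5f₃p)/(3(f₃u)^{1/3}u),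 and θ⁵ = f₃dr + f₂dq + f₁dp + f₀du + (f₃'r + f₂'q + f₁'p + f₀'u)dx. Then there exist smooth functions c_{ij} : Ω → ℝ (1 ≤ i < j ≤ 4) such that dθ⁴ = θ¹∧θ⁵ + Σ_{1≤i<j≤4} c_{ij} θⁱ∧θʲ on Ω; that is, in the expansion of dθ⁴ in the coframe, the coefficient of θ¹∧θ⁵ equals 1 and the coefficients of θ²∧θ⁵, θ³∧θ⁵ and θ⁴∧θ⁵ all vanish. -/
noncomputable section

open Real Set

/-- An alternating bilinear form with `n` in its kernel, expanded along vectors spanning the space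
modulo `n`. -/
lemma alternating_apply_eq_sum_of_span_four {V : Type*} [NormedAddCommGroup V] [NormedSpace ℝ V]
    (B : V →L[ℝ] V →L[ℝ] ℝ) (hB : ∀ v, B v v = 0) {n : V} (hn : B n = 0)
    (X₁ X₂ X₃ X₄ : V) {v w : V} {a₁ a₂ a₃ a₄ a b₁ b₂ b₃ b₄ b : ℝ}
    (hv : v = a₁ • X₁ + a₂ • X₂ + a₃ • X₃ + a₄ • X₄ + a • n)
    (hw : w = b₁ • X₁ + b₂ • X₂ + b₃ • X₃ + b₄ • X₄ + b • n) :
    B v w = B X₁ X₂ * (a₁ * b₂ - b₁ * a₂) + B X₁ X₃ * (a₁ * b₃ - b₁ * a₃) +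
      B X₁ X₄ * (a₁ * b₄ - b₁ * a₄) + B X₂ X₃ * (a₂ * b₃ - b₂ * a₃) +
      B X₂ X₄ * (a₂ * b₄ - b₂ * a₄) + B X₃ X₄ * (a₃ * b₄ - b₃ * a₄) := by
  have anti : ∀ x y, B x y = - B y x := fun x y => by
    have h := hB (x + y)
    simp only [map_add, add_apply, hB] at h
    linarith
  have hn' : ∀ x, B x n = 0 := fun x => by rw [anti, hn]; simp
  subst hv hw
  simp only [map_add, map_smul, add_apply, smul_apply,
    hn, hn', hB, smul_eq_mul, smul_zero]
  rw [anti X₂ X₁, anti X₃ X₁, anti X₄ X₁, anti X₃ X₂, anti X₄ X₂, anti X₄ X₃]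
  simp only [zero_apply]
  ring

lemma isOpen_Omega_s11 {f3 : ℝ → ℝ} (hf3 : Continuous f3) : IsOpen (Omega f3) :=
  (isOpen_lt continuous_const (continuous_apply 1)).inter
    (isOpen_lt continuous_const (hf3.comp (continuous_apply 0)))

section Smoothness

variable {f f3 : ℝ → ℝ}

lemma contDiffOn_coord (i : Fin 5) (s : Set E5) :
    ContDiffOn ℝ (⊤ : ℕ∞) (fun z : E5 => z i) s :=
  (contDiff_apply ℝ ℝ i).contDiffOn

lemma contDiffOn_comp_coord (hf : ContDiff ℝ (⊤ : ℕ∞) f) (i : Fin 5) (s : Set E5) :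
    ContDiffOn ℝ (⊤ : ℕ∞) (fun z : E5 => f (z i)) s :=
  (hf.comp (contDiff_apply ℝ ℝ i)).contDiffOn

lemma contDiff_deriv_of_smooth (hf : ContDiff ℝ (⊤ : ℕ∞) f) :
    ContDiff ℝ (⊤ : ℕ∞) (deriv f) :=
  (contDiff_infty_iff_deriv.1 hf).2

lemma contDiffOn_f3_mul_u_rpow (hf3 : ContDiff ℝ (⊤ : ℕ∞) f3) (e : ℝ) :
    ContDiffOn ℝ (⊤ : ℕ∞) (fun z : E5 => (f3 (z 0) * z 1) ^ e) (Omega f3) :=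
  ((contDiffOn_comp_coord hf3 0 _).mul (contDiffOn_coord 1 _)).rpow_const_of_ne
    fun _ hz => (mul_pos hz.2 hz.1).ne'

lemma contDiffOn_θ3d_factor (hf3 : ContDiff ℝ (⊤ : ℕ∞) f3) :
    ContDiffOn ℝ (⊤ : ℕ∞) (fun z : E5 => (f3 (z 0) / (z 1) ^ 2) ^ ((1 : ℝ) / 3)) (Omega f3) :=
  ((contDiffOn_comp_coord hf3 0 _).div ((contDiffOn_coord 1 _).pow 2)
    fun _ hz => (pow_pos hz.1 2).ne').rpow_const_of_ne
      fun _ hz => (div_pos hz.2 (pow_pos hz.1 2)).ne'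

lemma contDiffOn_a6d (hf3 : ContDiff ℝ (⊤ : ℕ∞) f3) :
    ContDiffOn ℝ (⊤ : ℕ∞) (a6d f3) (Omega f3) :=
  (((contDiffOn_comp_coord hf3 0 _).pow 2).div (contDiffOn_coord 1 _)
    fun _ hz => hz.1.ne').rpow_const_of_ne
      fun _ hz => (div_pos (pow_pos hz.2 2) hz.1).ne'

lemma a_denominator_ne_zero {z : E5} (hz : z ∈ Omega f3) :
    3 * (f3 (z 0) * z 1) ^ ((1 : ℝ) / 3) * z 1 ≠ 0 :=
  (mul_pos (mul_pos three_pos (rpow_pos_of_pos (mul_pos hz.2 hz.1) _)) hz.1).ne'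

lemma contDiffOn_a_denominator (hf3 : ContDiff ℝ (⊤ : ℕ∞) f3) :
    ContDiffOn ℝ (⊤ : ℕ∞)
      (fun z : E5 => 3 * (f3 (z 0) * z 1) ^ ((1 : ℝ) / 3) * z 1) (Omega f3) :=
  (contDiffOn_const.mul (contDiffOn_f3_mul_u_rpow hf3 _)).mul (contDiffOn_coord 1 _)

lemma contDiffOn_a4d (hf3 : ContDiff ℝ (⊤ : ℕ∞) f3) :
    ContDiffOn ℝ (⊤ : ℕ∞) (a4d f3) (Omega f3) := by
  have h0 := contDiffOn_comp_coord hf3 0 (Omega f3)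
  have h0' := contDiffOn_comp_coord (contDiff_deriv_of_smooth hf3) 0 (Omega f3)
  have hc := fun i => contDiffOn_coord i (Omega f3)
  exact ((((contDiffOn_const.mul h0).mul ((hc 2).pow 2)).sub ((h0'.mul (hc 2)).mul (hc 1))).sub
    (((contDiffOn_const.mul h0).mul (hc 3)).mul (hc 1))).div (contDiffOn_a_denominator hf3)
      fun _ hz => a_denominator_ne_zero hz

lemma contDiffOn_a5d (hf3 : ContDiff ℝ (⊤ : ℕ∞) f3) :
    ContDiffOn ℝ (⊤ : ℕ∞) (a5d f3) (Omega f3) := by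
  have h0 := contDiffOn_comp_coord hf3 0 (Omega f3)
  have h0' := contDiffOn_comp_coord (contDiff_deriv_of_smooth hf3) 0 (Omega f3)
  have hc := fun i => contDiffOn_coord i (Omega f3)
  exact ((h0'.mul (hc 1)).sub ((contDiffOn_const.mul h0).mul (hc 2))).div
    (contDiffOn_a_denominator hf3) fun _ hz => a_denominator_ne_zero hz

lemma contDiffOn_θ1d (hf3 : ContDiff ℝ (⊤ : ℕ∞) f3) :
    ContDiffOn ℝ (⊤ : ℕ∞) (θ1d f3) (Omega f3) :=
  (contDiffOn_f3_mul_u_rpow hf3 _).smul contDiffOn_const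

lemma contDiffOn_θ4d (hf3 : ContDiff ℝ (⊤ : ℕ∞) f3) :
    ContDiffOn ℝ (⊤ : ℕ∞) (θ4d f3) (Omega f3) := by
  have hc := fun i => contDiffOn_coord i (Omega f3)
  have h2 : ContDiffOn ℝ (⊤ : ℕ∞) ω2 (Omega f3) :=
    ((hc 1).inv fun _ hz => hz.1.ne').smul (contDiffOn_const.sub ((hc 2).smul contDiffOn_const))
  have h3 : ContDiffOn ℝ (⊤ : ℕ∞) ω3 (Omega f3) :=
    contDiffOn_const.sub ((hc 3).smul contDiffOn_const)
  have h4 : ContDiffOn ℝ (⊤ : ℕ∞) ω4 (Omega f3) :=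
    contDiffOn_const.sub ((hc 4).smul contDiffOn_const)
  exact (((contDiffOn_a4d hf3).smul h2).add ((contDiffOn_a5d hf3).smul h3)).add
    ((contDiffOn_a6d hf3).smul h4)

lemma contDiffOn_ω5d {f0 f1 f2 : ℝ → ℝ} (hf0 : ContDiff ℝ (⊤ : ℕ∞) f0)
    (hf1 : ContDiff ℝ (⊤ : ℕ∞) f1) (hf2 : ContDiff ℝ (⊤ : ℕ∞) f2)
    (hf3 : ContDiff ℝ (⊤ : ℕ∞) f3) (s : Set E5) :
    ContDiffOn ℝ (⊤ : ℕ∞) (ω5d f0 f1 f2 f3) s := by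
  have hc := fun i => contDiffOn_coord i s
  have hs : ∀ {g : ℝ → ℝ}, ContDiff ℝ (⊤ : ℕ∞) g → ∀ l : E5 →L[ℝ] ℝ,
      ContDiffOn ℝ (⊤ : ℕ∞) (fun z : E5 => g (z 0) • l) s :=
    fun hg _ => (contDiffOn_comp_coord hg 0 s).smul contDiffOn_const
  have hd : ∀ {g : ℝ → ℝ}, ContDiff ℝ (⊤ : ℕ∞) g → ∀ i,
      ContDiffOn ℝ (⊤ : ℕ∞) (fun z : E5 => deriv g (z 0) * z i) s :=
    fun hg i => (contDiffOn_comp_coord (contDiff_deriv_of_smooth hg) 0 s).mul (hc i)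
  exact ((((hs hf3 dR).add (hs hf2 dQ)).add (hs hf1 dP)).add (hs hf0 dU)).add
    (((((hd hf3 4).add (hd hf2 3)).add (hd hf1 2)).add (hd hf0 1)).smul contDiffOn_const)

end Smoothness

/-- The coordinate vector `∂/∂r`. -/
def vecR : E5 := ![0, 0, 0, 0, 1]

/-- The vector fields dual, modulo `∂/∂r`, to `θ¹, ω², θ³, θ⁴`. -/
def frame (f3 : ℝ → ℝ) (i : Fin 4) (z : E5) : E5 :=
  let g := (f3 (z 0) * z 1) ^ (-(1 : ℝ) / 3)
  let b := (f3 (z 0) / (z 1) ^ 2) ^ ((1 : ℝ) / 3)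
  ![![g⁻¹, g⁻¹ * z 2, g⁻¹ * z 3, g⁻¹ * z 4, 0],
    ![0, z 1, z 2, -((a4d f3 z + a5d f3 z * z 2) / a6d f3 z), 0],
    ![0, 0, b⁻¹, -(a5d f3 z * b⁻¹ / a6d f3 z), 0],
    ![0, 0, 0, (a6d f3 z)⁻¹, 0]] i

lemma a6d_pos {f3 : ℝ → ℝ} {z : E5} (hz : z ∈ Omega f3) : 0 < a6d f3 z :=
  rpow_pos_of_pos (div_pos (pow_pos hz.2 2) hz.1) _

lemma contDiffOn_frame {f3 : ℝ → ℝ} (hf3 : ContDiff ℝ (⊤ : ℕ∞) f3) (i : Fin 4) :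
    ContDiffOn ℝ (⊤ : ℕ∞) (frame f3 i) (Omega f3) := by
  have hc := fun i => contDiffOn_coord i (Omega f3)
  have hg := (contDiffOn_f3_mul_u_rpow hf3 (-(1 : ℝ) / 3)).inv
    fun z hz => (rpow_pos_of_pos (mul_pos hz.2 hz.1) _).ne'
  have hb := (contDiffOn_θ3d_factor hf3).inv
    fun z hz => (rpow_pos_of_pos (div_pos hz.2 (pow_pos hz.1 2)) _).ne'
  have h4 := contDiffOn_a4d hf3
  have h5 := contDiffOn_a5d hf3
  have h6 := contDiffOn_a6d hf3
  have h6' : ∀ z ∈ Omega f3, a6d f3 z ≠ 0 := fun _ hz => (a6d_pos hz).ne'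
  have h0 : ContDiffOn ℝ (⊤ : ℕ∞) (fun _ : E5 => (0 : ℝ)) (Omega f3) := contDiffOn_const
  rw [contDiffOn_pi]
  intro j
  fin_cases i
  · fin_cases j
    exacts [hg, hg.mul (hc 2), hg.mul (hc 3), hg.mul (hc 4), h0]
  · fin_cases j
    exacts [h0, hc 1, hc 2, ((h4.add (h5.mul (hc 2))).div h6 h6').neg, h0]
  · fin_cases j
    exacts [h0, h0, hb, ((h5.mul hb).div h6 h6').neg, h0]
  · fin_cases j
    exacts [h0, h0, h0, h6.inv h6', h0]

lemma eq_sum_frame {f3 : ℝ → ℝ} {z : E5} (hz : z ∈ Omega f3) (v : E5) :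
    v = θ1d f3 z v • frame f3 0 z + ω2 z v • frame f3 1 z + θ3d f3 z v • frame f3 2 z +
      θ4d f3 z v • frame f3 3 z + v 4 • vecR := by
  have hg := (rpow_pos_of_pos (mul_pos hz.2 hz.1) (-(1 : ℝ) / 3)).ne'
  have hb := (rpow_pos_of_pos (div_pos hz.2 (pow_pos hz.1 2)) ((1 : ℝ) / 3)).ne'
  have h6 := (a6d_pos hz).ne'
  have hu := hz.1.ne'
  ext j
  simp only [θ1d, ω2, θ3d, θ4d, ω3, ω4, dX, dU, dP, dQ, frame, vecR]
  generalize (f3 (z 0) * z 1) ^ (-(1 : ℝ) / 3) = g at hg ⊢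
  generalize (f3 (z 0) / (z 1) ^ 2) ^ ((1 : ℝ) / 3) = b at hb ⊢
  generalize a6d f3 z = a6 at h6 ⊢
  fin_cases j <;> simp <;> field_simp <;> ring

/-- The 2-form `dθ⁴ − θ¹∧θ⁵`. -/
def remainder (f0 f1 f2 f3 : ℝ → ℝ) (z : E5) : E5 →L[ℝ] E5 →L[ℝ] ℝ :=
  fderiv ℝ (θ4d f3) z - (fderiv ℝ (θ4d f3) z).flip -
    ((θ1d f3 z).smulRight (ω5d f0 f1 f2 f3 z) - (ω5d f0 f1 f2 f3 z).smulRight (θ1d f3 z))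

lemma remainder_apply (f0 f1 f2 f3 : ℝ → ℝ) (z v w : E5) :
    remainder f0 f1 f2 f3 z v w =
      extD (θ4d f3) z v w - wedge (θ1d f3) (ω5d f0 f1 f2 f3) z v w := by
  simp [remainder, extD, wedge]
  ring

lemma contDiffOn_remainder_apply {f0 f1 f2 f3 : ℝ → ℝ} (hf0 : ContDiff ℝ (⊤ : ℕ∞) f0)
    (hf1 : ContDiff ℝ (⊤ : ℕ∞) f1) (hf2 : ContDiff ℝ (⊤ : ℕ∞) f2)
    (hf3 : ContDiff ℝ (⊤ : ℕ∞) f3) {X Y : E5 → E5}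
    (hX : ContDiffOn ℝ (⊤ : ℕ∞) X (Omega f3)) (hY : ContDiffOn ℝ (⊤ : ℕ∞) Y (Omega f3)) :
    ContDiffOn ℝ (⊤ : ℕ∞) (fun z => remainder f0 f1 f2 f3 z (X z) (Y z)) (Omega f3) := by
  have hD : ContDiffOn ℝ (⊤ : ℕ∞) (fderiv ℝ (θ4d f3)) (Omega f3) :=
    (contDiffOn_θ4d hf3).fderiv_of_isOpen (isOpen_Omega_s11 hf3.continuous) le_rfl
  have h1 := contDiffOn_θ1d hf3
  have h5 := contDiffOn_ω5d hf0 hf1 hf2 hf3 (Omega f3)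
  simp only [remainder_apply, extD, wedge]
  exact (((hD.clm_apply hX).clm_apply hY).sub ((hD.clm_apply hY).clm_apply hX)).sub
    (((h1.clm_apply hX).mul (h5.clm_apply hY)).sub ((h1.clm_apply hY).mul (h5.clm_apply hX)))

lemma f3_mul_θ1d_factor {f3 : ℝ → ℝ} {z : E5} (hz : z ∈ Omega f3) :
    (f3 (z 0) * z 1) ^ (-(1 : ℝ) / 3) * f3 (z 0) = a6d f3 z := by
  obtain ⟨hu, hf⟩ := hz
  rw [a6d, mul_rpow hf.le hu.le, div_rpow (sq_nonneg _) hu.le, ← rpow_natCast, ← rpow_mul hf.le,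
    neg_div, rpow_neg hu.le, div_eq_mul_inv, mul_right_comm, ← rpow_add_one hf.ne']
  norm_num [div_eq_mul_inv]

lemma θ4d_add_smul_vecR (f3 : ℝ → ℝ) (z : E5) (t : ℝ) :
    θ4d f3 (z + t • vecR) = θ4d f3 z - t • a6d f3 z • dX := by
  ext v
  simp [θ4d, ω2, ω3, ω4, a4d, a5d, a6d, vecR]
  ring

lemma fderiv_θ4d_vecR {f3 : ℝ → ℝ} {z : E5} (h : DifferentiableAt ℝ (θ4d f3) z) :
    fderiv ℝ (θ4d f3) z vecR = -(a6d f3 z • dX) := by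
  rw [← h.lineDeriv_eq_fderiv, lineDeriv]
  simp only [θ4d_add_smul_vecR]
  have := ((hasDerivAt_id (0 : ℝ)).smul_const (a6d f3 z • dX)).const_sub (θ4d f3 z)
  simpa using this.deriv

lemma fderiv_θ4d_apply_vecR {f3 : ℝ → ℝ} {z : E5} (h : DifferentiableAt ℝ (θ4d f3) z) (w : E5) :
    fderiv ℝ (θ4d f3) z w vecR = 0 := by
  have h0 : (fun y => θ4d f3 y vecR) = fun _ => 0 := by
    ext y
    simp [θ4d, ω2, ω3, ω4, dX, dU, dP, dQ, vecR]
  have := fderiv_clm_apply h (differentiableAt_const vecR)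
  rw [h0] at this
  simpa using (congrArg (fun L : E5 →L[ℝ] ℝ => L w) this).symm

lemma remainder_vecR (f0 f1 f2 : ℝ → ℝ) {f3 : ℝ → ℝ} (hf3 : ContDiff ℝ (⊤ : ℕ∞) f3) {z : E5}
    (hz : z ∈ Omega f3) : remainder f0 f1 f2 f3 z vecR = 0 := by
  have h : DifferentiableAt ℝ (θ4d f3) z :=
    ((contDiffOn_θ4d hf3).contDiffAt ((isOpen_Omega_s11 hf3.continuous).mem_nhds hz)).differentiableAt
      (by simp)
  ext w
  rw [remainder_apply, extD, fderiv_θ4d_vecR h, fderiv_θ4d_apply_vecR h, ← f3_mul_θ1d_factor hz]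
  simp [wedge, θ1d, ω5d, dX, dU, dP, dQ, dR, vecR]
  ring

/-- In the final structure equations of the direct equivalence
problem, `dθ⁴` involves `θ⁵` only through the term `θ¹∧θ⁵` with unit coefficient:
`dθ⁴ = θ¹∧θ⁵ + Σ_{1≤i<j≤4} c_{ij} θⁱ∧θʲ` for suitable smooth functions `c_{ij}`. -/
theorem direct_structure_eq_four
    (f0 f1 f2 f3 : ℝ → ℝ)
    (hf0 : ContDiff ℝ (⊤ : ℕ∞) f0) (hf1 : ContDiff ℝ (⊤ : ℕ∞) f1)
    (hf2 : ContDiff ℝ (⊤ : ℕ∞) f2) (hf3 : ContDiff ℝ (⊤ : ℕ∞) f3) :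
    ∃ c12 c13 c14 c23 c24 c34 : E5 → ℝ,
      ContDiffOn ℝ (⊤ : ℕ∞) c12 (Omega f3) ∧ ContDiffOn ℝ (⊤ : ℕ∞) c13 (Omega f3) ∧
      ContDiffOn ℝ (⊤ : ℕ∞) c14 (Omega f3) ∧ ContDiffOn ℝ (⊤ : ℕ∞) c23 (Omega f3) ∧
      ContDiffOn ℝ (⊤ : ℕ∞) c24 (Omega f3) ∧ ContDiffOn ℝ (⊤ : ℕ∞) c34 (Omega f3) ∧
      ∀ z ∈ Omega f3, ∀ v w : E5,
        extD (θ4d f3) z v w =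
          wedge (θ1d f3) (ω5d f0 f1 f2 f3) z v w +
            c12 z * wedge (θ1d f3) ω2 z v w + c13 z * wedge (θ1d f3) (θ3d f3) z v w +
            c14 z * wedge (θ1d f3) (θ4d f3) z v w + c23 z * wedge ω2 (θ3d f3) z v w +
            c24 z * wedge ω2 (θ4d f3) z v w + c34 z * wedge (θ3d f3) (θ4d f3) z v w := by
  have hs := fun i j => contDiffOn_remainder_apply hf0 hf1 hf2 hf3
    (contDiffOn_frame hf3 i) (contDiffOn_frame hf3 j)
  refine ⟨_, _, _, _, _, _, hs 0 1, hs 0 2, hs 0 3, hs 1 2, hs 1 3, hs 2 3, fun z hz v w => ?_⟩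
  have hB : ∀ v, remainder f0 f1 f2 f3 z v v = 0 := fun v => by
    simp [remainder_apply, extD, wedge]
  have key := alternating_apply_eq_sum_of_span_four _ hB (remainder_vecR f0 f1 f2 hf3 hz)
    _ _ _ _ (eq_sum_frame hz v) (eq_sum_frame hz w)
  rw [remainder_apply] at key
  simp only [wedge] at key ⊢
  linarith
end
end

section
/- Let f₀, f₁, f₂, f₃ : ℝ → ℝ be smooth and let Ω = {(x,u,p,q,r) ∈ ℝ⁵ : u > 0, f₃(x) > 0}. Define on Ω the 1-forms of the gauge equivalence problem: θ¹ = f₃^{−1/3}dx, θ² = (du − p dx)/u, θ³ = (f₃^{1/3}/u²)[ (p² − qu)dx − p du + u dp ], θ⁴ = −(1/(3f₃^{1/3}u³))[ (3f₃u²r + f₃'u²q − f₃'up² − 9f₃upq + 6f₃p³)dx + (f₃'up + 3f₃uq − 6f₃p²)du + (6f₃p − f₃'u)u dp − 3f₃u² dq ]. Then the structure equations dθ¹ = 0, dθ² = θ¹∧θ³, and dθ³ = θ¹∧θ⁴ hold at every point of Ω. -/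
noncomputable section

open Real Set

/-- The gauge-invariant coframe element `θ¹ = f₃^{-1/3} dx`. -/
def σ1 (f3 : ℝ → ℝ) : E5 → E5 →L[ℝ] ℝ := fun z => ((f3 (z 0)) ^ (-(1 : ℝ) / 3)) • dX

/-- The gauge-invariant coframe element
`θ³ = (f₃^{1/3}/u²)[(p² − qu)dx − p du + u dp]`. -/
def σ3 (f3 : ℝ → ℝ) : E5 → E5 →L[ℝ] ℝ := fun z =>
  ((f3 (z 0)) ^ ((1 : ℝ) / 3) / (z 1) ^ 2) •
    (((z 2) ^ 2 - z 3 * z 1) • dX - z 2 • dU + z 1 • dP)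

/-- The gauge-invariant coframe element `θ⁴`. -/
def σ4 (f3 : ℝ → ℝ) : E5 → E5 →L[ℝ] ℝ := fun z =>
  (-(1 / (3 * (f3 (z 0)) ^ ((1 : ℝ) / 3) * (z 1) ^ 3))) •
    ((3 * f3 (z 0) * (z 1) ^ 2 * z 4 + deriv f3 (z 0) * (z 1) ^ 2 * z 3 -
        deriv f3 (z 0) * z 1 * (z 2) ^ 2 - 9 * f3 (z 0) * z 1 * z 2 * z 3 +
        6 * f3 (z 0) * (z 2) ^ 3) • dX +
      (deriv f3 (z 0) * z 1 * z 2 + 3 * f3 (z 0) * z 1 * z 3 -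
        6 * f3 (z 0) * (z 2) ^ 2) • dU +
      ((6 * f3 (z 0) * z 2 - deriv f3 (z 0) * z 1) * z 1) • dP -
      (3 * f3 (z 0) * (z 1) ^ 2) • dQ)

/-- Exterior derivative of a 1-form with components only along `dx`, `du`, `dp`. -/
theorem extD_of_hasFDerivAt {θ : E5 → E5 →L[ℝ] ℝ} {a b c : E5 → ℝ} {a' b' c' : E5 →L[ℝ] ℝ}
    {z : E5} (hθ : θ = fun y => a y • dX + b y • dU + c y • dP)
    (ha : HasFDerivAt a a' z) (hb : HasFDerivAt b b' z) (hc : HasFDerivAt c c' z) (v w : E5) :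
    extD θ z v w = (a' v * w 0 - a' w * v 0) + (b' v * w 1 - b' w * v 1) +
      (c' v * w 2 - c' w * v 2) := by
  have h : HasFDerivAt (fun y => a y • dX + b y • dU + c y • dP)
      (a'.smulRight dX + b'.smulRight dU + c'.smulRight dP) z :=
    ((ha.smul_const dX).add (hb.smul_const dU)).add (hc.smul_const dP)
  rw [extD, hθ, h.fderiv]
  simp [dX, dU, dP]
  ring

/-- Derivative of a real power of a positive function of `x`. -/
theorem hasFDerivAt_rpow_coord_zero {f : ℝ → ℝ} {z : E5} (hf : DifferentiableAt ℝ f (z 0))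
    (hz : 0 < f (z 0)) (s : ℝ) :
    HasFDerivAt (fun y : E5 => f (y 0) ^ s)
      ((deriv f (z 0) * s * f (z 0) ^ (s - 1)) • (ContinuousLinearMap.proj 0 : E5 →L[ℝ] ℝ)) z :=
  HasDerivAt.comp_hasFDerivAt (h₂ := fun t => f t ^ s) z
    (hf.hasDerivAt.rpow_const (p := s) (Or.inl hz.ne')) (hasFDerivAt_coord 0 z)

/-- The first three structure equations of the gauge equivalence
problem: `dθ¹ = 0`, `dθ² = θ¹∧θ³`, `dθ³ = θ¹∧θ⁴` on `Ω`. -/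
theorem gauge_structure_eqs_one_two_three
    (f0 f1 f2 f3 : ℝ → ℝ)
    (hf0 : ContDiff ℝ (⊤ : ℕ∞) f0) (hf1 : ContDiff ℝ (⊤ : ℕ∞) f1)
    (hf2 : ContDiff ℝ (⊤ : ℕ∞) f2) (hf3 : ContDiff ℝ (⊤ : ℕ∞) f3) :
    ∀ z ∈ Omega f3, ∀ v w : E5,
      extD (σ1 f3) z v w = 0 ∧
      extD ω2 z v w = wedge (σ1 f3) (σ3 f3) z v w ∧
      extD (σ3 f3) z v w = wedge (σ1 f3) (σ4 f3) z v w := by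
  intro z hz v w
  obtain ⟨hu, hf⟩ := hz
  have hd : DifferentiableAt ℝ f3 (z 0) := hf3.contDiffAt.differentiableAt (by simp)
  have hzero : HasFDerivAt (fun _ : E5 => (0 : ℝ)) (0 : E5 →L[ℝ] ℝ) z := hasFDerivAt_const 0 z
  have hinv : HasFDerivAt (fun y : E5 => (y 1)⁻¹) _ z :=
    (hasDerivAt_inv hu.ne').comp_hasFDerivAt z (hasFDerivAt_coord 1 z)
  have hp := hasFDerivAt_coord 2 z
  have hq := hasFDerivAt_coord 3 z
  have hg := hasFDerivAt_rpow_coord_zero hd hf (1 / 3)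
  obtain ⟨g, hgdef⟩ : ∃ g, f3 (z 0) ^ ((1 : ℝ) / 3) = g := ⟨_, rfl⟩
  have hg0 : 0 < g := hgdef ▸ rpow_pos_of_pos hf _
  have hcube : f3 (z 0) = g ^ 3 := by
    rw [← hgdef, ← rpow_natCast, ← rpow_mul hf.le]; norm_num
  have hneg : f3 (z 0) ^ (-(1 : ℝ) / 3) = g⁻¹ := by
    rw [← hgdef, ← rpow_neg hf.le]; norm_num
  have hpred : f3 (z 0) ^ ((1 : ℝ) / 3 - 1) = g / g ^ 3 := by
    rw [rpow_sub_one hf.ne', hgdef, hcube]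
  refine ⟨?_, ?_, ?_⟩
  · rw [extD_of_hasFDerivAt (by funext y; simp [σ1])
      (hasFDerivAt_rpow_coord_zero hd hf (-1 / 3)) hzero hzero]
    simp
    ring
  · rw [extD_of_hasFDerivAt (a := fun y => -(y 2 * (y 1)⁻¹)) (b := fun y => (y 1)⁻¹)
      (by funext y; ext t; simp [ω2]; ring) (hp.mul hinv).neg hinv hzero]
    simp only [wedge, σ1, σ3, hneg, hgdef]
    simp [dX, dU, dP]
    field_simp
    ring
  · rw [extD_of_hasFDerivAt
      (a := fun y => f3 (y 0) ^ ((1 : ℝ) / 3) *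
        ((y 2 * (y 1)⁻¹) * (y 2 * (y 1)⁻¹) - y 3 * (y 1)⁻¹))
      (b := fun y => -(f3 (y 0) ^ ((1 : ℝ) / 3) * (y 2 * ((y 1)⁻¹ * (y 1)⁻¹))))
      (c := fun y => f3 (y 0) ^ ((1 : ℝ) / 3) * (y 1)⁻¹)
      (by
        funext y; ext t
        by_cases hy : y 1 = 0
        · simp [σ3, hy]
        · simp [σ3]; field_simp; ring)
      (hg.mul (((hp.mul hinv).mul (hp.mul hinv)).sub (hq.mul hinv)))
      (hg.mul (hp.mul (hinv.mul hinv))).neg (hg.mul hinv)]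
    simp only [wedge, σ1, σ4, dX, dU, dP, dQ, add_apply, sub_apply, neg_apply, smul_apply,
      ContinuousLinearMap.proj_apply, smul_eq_mul, Pi.mul_apply, hneg, hgdef, hpred]
    simp only [hcube]
    field_simp
    ring
end
end

section
/- Let f₀, f₁, f₂, f₃ : ℝ → ℝ be smooth and let Ω = {(x,u,p,q,r) ∈ ℝ⁵ : u > 0, f₃(x) > 0}. Let θ¹, θ², θ³, θ⁴ be the gauge-invariant coframe forms θ¹ = f₃^{−1/3}dx, θ² = (du − p dx)/u, θ³ = (f₃^{1/3}/u²)[(p² − qu)dx − p du + u dp], θ⁴ = −(1/(3f₃^{1/3}u³))[(3f₃u²r + f₃'u²q − f₃'up² − 9f₃upq + 6f₃p³)dx + (f₃'up + 3f₃uq − 6f₃p²)du + (6f₃p − f₃'u)u dp − 3f₃u² dq], and let θ⁵ be the Fréchet differential of I(x,u,p,q,r) = (f₃r + f₂q + f₁p)/u + f₀, explicitly θ⁵ = ((f₃'r + f₂'q + f₁'p)/u + f₀')dx − ((f₃r + f₂q + f₁p)/u²)du + (f₁/u)dp + (f₂/u)dq + (f₃/u)dr. Define I₁ = [ (f₃f₃''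 − 3f₁f₃ + f₂f₃' − (4/3)f₃'²)u + 3(f₃f₃' − 2f₂f₃)p − 9f₃²q ] / (3f₃^{4/3}u) and I₂ = (f₃'u − 3f₃p − f₂u)/(f₃^{2/3}u). Then the final structure equations dθ⁴ = I₁·θ¹∧θ³ + I₂·θ¹∧θ⁴ + θ¹∧θ⁵ and dθ⁵ = 0 hold at every point of Ω. -/
noncomputable section

open Real Set

/-- The fundamental invariant `I₁` of the gauge equivalence problem. -/
def I1g (f1 f2 f3 : ℝ → ℝ) : E5 → ℝ := fun z =>
  ((f3 (z 0) * deriv (deriv f3) (z 0) - 3 * f1 (z 0) * f3 (z 0) +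
      f2 (z 0) * deriv f3 (z 0) - (4 / 3) * (deriv f3 (z 0)) ^ 2) * z 1 +
    3 * (f3 (z 0) * deriv f3 (z 0) - 2 * f2 (z 0) * f3 (z 0)) * z 2 -
    9 * (f3 (z 0)) ^ 2 * z 3) / (3 * (f3 (z 0)) ^ ((4 : ℝ) / 3) * z 1)

/-- The fundamental invariant `I₂` of the gauge equivalence problem. -/
def I2g (f2 f3 : ℝ → ℝ) : E5 → ℝ := fun z =>
  (deriv f3 (z 0) * z 1 - 3 * f3 (z 0) * z 2 - f2 (z 0) * z 1) /
    ((f3 (z 0)) ^ ((2 : ℝ) / 3) * z 1)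

lemma fderiv_apply_eq_of_hasDerivAt_line {θ : E5 → E5 →L[ℝ] ℝ} {z v w : E5} {c : ℝ}
    (hθ : DifferentiableAt ℝ θ z) (h : HasDerivAt (fun t : ℝ => θ (z + t • v) w) c 0) :
    fderiv ℝ θ z v w = c := by
  have happly : HasFDerivAt (fun y => θ y w) ((fderiv ℝ θ z).flip w) z := by
    simpa using hθ.hasFDerivAt.clm_apply (hasFDerivAt_const w z)
  exact (happly.hasLineDerivAt v).unique h

lemma hasDerivAt_coord_line (z v : E5) (i : Fin 5) :
    HasDerivAt (fun t : ℝ => z i + t * v i) (v i) 0 := by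
  simpa using ((hasDerivAt_id (0 : ℝ)).mul_const (v i)).const_add (z i)

lemma hasDerivAt_comp_line {f : ℝ → ℝ} (hf : Differentiable ℝ f) (a b : ℝ) :
    HasDerivAt (fun t : ℝ => f (a + t * b)) (deriv f a * b) 0 := by
  have hline : HasDerivAt (fun t : ℝ => a + t * b) b 0 := by
    simpa using ((hasDerivAt_id (0 : ℝ)).mul_const b).const_add a
  have hf' : HasDerivAt f (deriv f a) (a + 0 * b) := by
    simpa using (hf a).hasDerivAt
  exact hf'.comp (0 : ℝ) hline

lemma differentiable_deriv_of_contDiff_infty {f : ℝ → ℝ} (hf : ContDiff ℝ (⊤ : ℕ∞) f) :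
    Differentiable ℝ (deriv f) :=
  (contDiff_infty_iff_deriv.mp hf).2.differentiable (by simp)

lemma differentiableAt_ω5g {f0 f1 f2 f3 : ℝ → ℝ}
    (hf0 : ContDiff ℝ (⊤ : ℕ∞) f0) (hf1 : ContDiff ℝ (⊤ : ℕ∞) f1)
    (hf2 : ContDiff ℝ (⊤ : ℕ∞) f2) (hf3 : ContDiff ℝ (⊤ : ℕ∞) f3)
    {z : E5} (hu : z 1 ≠ 0) : DifferentiableAt ℝ (ω5g f0 f1 f2 f3) z := by
  have h1 := hf1.differentiable (by simp)
  have h2 := hf2.differentiable (by simp)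
  have h3 := hf3.differentiable (by simp)
  have d0 := differentiable_deriv_of_contDiff_infty hf0
  have d1 := differentiable_deriv_of_contDiff_infty hf1
  have d2 := differentiable_deriv_of_contDiff_infty hf2
  have d3 := differentiable_deriv_of_contDiff_infty hf3
  have hu2 : z 1 ^ 2 ≠ 0 := pow_ne_zero 2 hu
  unfold ω5g
  fun_prop (disch := assumption)

lemma differentiableAt_σ4 {f3 : ℝ → ℝ} (hf3 : ContDiff ℝ (⊤ : ℕ∞) f3)
    {z : E5} (hu : z 1 ≠ 0) (hf : 0 < f3 (z 0)) : DifferentiableAt ℝ (σ4 f3) z := by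
  have h3 := hf3.differentiable (by simp)
  have d3 := differentiable_deriv_of_contDiff_infty hf3
  have hg : DifferentiableAt ℝ (fun y : E5 => f3 (y 0) ^ ((1 : ℝ) / 3)) z :=
    DifferentiableAt.rpow_const (by fun_prop) (Or.inl hf.ne')
  have hden : 3 * f3 (z 0) ^ ((1 : ℝ) / 3) * z 1 ^ 3 ≠ 0 := by positivity
  have hc : DifferentiableAt ℝ
      (fun y : E5 => -(1 / (3 * f3 (y 0) ^ ((1 : ℝ) / 3) * y 1 ^ 3))) z := by
    fun_prop (disch := assumption)
  unfold σ4
  exact hc.smul (by fun_prop)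

lemma fderiv_ω5g_apply {f0 f1 f2 f3 : ℝ → ℝ}
    (hf0 : ContDiff ℝ (⊤ : ℕ∞) f0) (hf1 : ContDiff ℝ (⊤ : ℕ∞) f1)
    (hf2 : ContDiff ℝ (⊤ : ℕ∞) f2) (hf3 : ContDiff ℝ (⊤ : ℕ∞) f3)
    {z : E5} (hu : z 1 ≠ 0) (v w : E5) :
    fderiv ℝ (ω5g f0 f1 f2 f3) z v w =
      (((deriv (deriv f3) (z 0) * z 4 + deriv (deriv f2) (z 0) * z 3 +
            deriv (deriv f1) (z 0) * z 2) * v 0 + deriv f3 (z 0) * v 4 + deriv f2 (z 0) * v 3 +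
            deriv f1 (z 0) * v 2) / z 1 -
          (deriv f3 (z 0) * z 4 + deriv f2 (z 0) * z 3 + deriv f1 (z 0) * z 2) * v 1 / z 1 ^ 2 +
          deriv (deriv f0) (z 0) * v 0) * w 0 -
        (((deriv f3 (z 0) * z 4 + deriv f2 (z 0) * z 3 + deriv f1 (z 0) * z 2) * v 0 +
            f3 (z 0) * v 4 + f2 (z 0) * v 3 + f1 (z 0) * v 2) / z 1 ^ 2 -
          2 * (f3 (z 0) * z 4 + f2 (z 0) * z 3 + f1 (z 0) * z 2) * v 1 / z 1 ^ 3) * w 1 +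
        (deriv f1 (z 0) * v 0 / z 1 - f1 (z 0) * v 1 / z 1 ^ 2) * w 2 +
        (deriv f2 (z 0) * v 0 / z 1 - f2 (z 0) * v 1 / z 1 ^ 2) * w 3 +
        (deriv f3 (z 0) * v 0 / z 1 - f3 (z 0) * v 1 / z 1 ^ 2) * w 4 := by
  have h1 := hasDerivAt_comp_line (hf1.differentiable (by simp)) (z 0) (v 0)
  have h2 := hasDerivAt_comp_line (hf2.differentiable (by simp)) (z 0) (v 0)
  have h3 := hasDerivAt_comp_line (hf3.differentiable (by simp)) (z 0) (v 0)
  have d0 := hasDerivAt_comp_line (differentiable_deriv_of_contDiff_infty hf0) (z 0) (v 0)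
  have d1 := hasDerivAt_comp_line (differentiable_deriv_of_contDiff_infty hf1) (z 0) (v 0)
  have d2 := hasDerivAt_comp_line (differentiable_deriv_of_contDiff_infty hf2) (z 0) (v 0)
  have d3 := hasDerivAt_comp_line (differentiable_deriv_of_contDiff_infty hf3) (z 0) (v 0)
  have hU := hasDerivAt_coord_line z v 1
  have hP := hasDerivAt_coord_line z v 2
  have hQ := hasDerivAt_coord_line z v 3
  have hR := hasDerivAt_coord_line z v 4
  have hu0 : z 1 + 0 * v 1 ≠ 0 := by simpa using hu
  have hA := (((d3.mul hR).add (d2.mul hQ)).add (d1.mul hP)).div hU hu0 |>.add d0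
  have hB := (((h3.mul hR).add (h2.mul hQ)).add (h1.mul hP)).div (hU.pow 2) (pow_ne_zero 2 hu0)
  have hsum := ((((hA.mul_const (w 0)).sub (hB.mul_const (w 1))).add
    ((h1.div hU hu0).mul_const (w 2))).add ((h2.div hU hu0).mul_const (w 3))).add
    ((h3.div hU hu0).mul_const (w 4))
  refine fderiv_apply_eq_of_hasDerivAt_line (differentiableAt_ω5g hf0 hf1 hf2 hf3 hu) ?_
  refine (hsum.congr_deriv ?_).congr_of_eventuallyEq (Filter.Eventually.of_forall fun t => ?_)
  · simp only [zero_mul, add_zero, Pi.add_apply, Pi.mul_apply, Pi.pow_apply]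
    field_simp
    ring
  · simp only [ω5g, dX, dU, dP, dQ, dR, add_apply, sub_apply, smul_apply,
      ContinuousLinearMap.proj_apply, smul_eq_mul, Pi.add_apply, Pi.sub_apply, Pi.mul_apply,
      Pi.pow_apply, Pi.div_apply, Pi.smul_apply]

lemma fderiv_σ4_apply {f3 : ℝ → ℝ} (hf3 : ContDiff ℝ (⊤ : ℕ∞) f3)
    {z : E5} (hu : z 1 ≠ 0) (hf : 0 < f3 (z 0)) {g : ℝ} (hg : f3 (z 0) ^ ((1 : ℝ) / 3) = g)
    (v w : E5) :
    fderiv ℝ (σ4 f3) z v w =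
      (deriv f3 (z 0) * v 0 / (9 * g ^ 4 * z 1 ^ 3) + v 1 / (g * z 1 ^ 4)) *
        ((3 * f3 (z 0) * (z 1) ^ 2 * z 4 + deriv f3 (z 0) * (z 1) ^ 2 * z 3 -
            deriv f3 (z 0) * z 1 * (z 2) ^ 2 - 9 * f3 (z 0) * z 1 * z 2 * z 3 +
            6 * f3 (z 0) * (z 2) ^ 3) * w 0 +
          (deriv f3 (z 0) * z 1 * z 2 + 3 * f3 (z 0) * z 1 * z 3 -
            6 * f3 (z 0) * (z 2) ^ 2) * w 1 +
          ((6 * f3 (z 0) * z 2 - deriv f3 (z 0) * z 1) * z 1) * w 2 -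
          (3 * f3 (z 0) * (z 1) ^ 2) * w 3) -
      1 / (3 * g * z 1 ^ 3) *
        ((3 * deriv f3 (z 0) * v 0 * z 1 ^ 2 * z 4 + 6 * f3 (z 0) * z 1 * v 1 * z 4 +
            3 * f3 (z 0) * z 1 ^ 2 * v 4 +
            deriv (deriv f3) (z 0) * v 0 * (z 1 ^ 2 * z 3 - z 1 * z 2 ^ 2) +
            deriv f3 (z 0) * (2 * z 1 * v 1 * z 3 + z 1 ^ 2 * v 3 - v 1 * z 2 ^ 2 -
              2 * z 1 * z 2 * v 2) -
            9 * deriv f3 (z 0) * v 0 * z 1 * z 2 * z 3 -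
            9 * f3 (z 0) * (v 1 * z 2 * z 3 + z 1 * v 2 * z 3 + z 1 * z 2 * v 3) +
            6 * deriv f3 (z 0) * v 0 * z 2 ^ 3 + 18 * f3 (z 0) * z 2 ^ 2 * v 2) * w 0 +
          (deriv (deriv f3) (z 0) * v 0 * z 1 * z 2 +
            deriv f3 (z 0) * (v 1 * z 2 + z 1 * v 2) +
            3 * deriv f3 (z 0) * v 0 * z 1 * z 3 + 3 * f3 (z 0) * (v 1 * z 3 + z 1 * v 3) -
            6 * deriv f3 (z 0) * v 0 * z 2 ^ 2 - 12 * f3 (z 0) * z 2 * v 2) * w 1 +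
          (6 * deriv f3 (z 0) * v 0 * z 1 * z 2 + 6 * f3 (z 0) * (v 1 * z 2 + z 1 * v 2) -
            deriv (deriv f3) (z 0) * v 0 * z 1 ^ 2 - 2 * deriv f3 (z 0) * z 1 * v 1) * w 2 -
          (3 * deriv f3 (z 0) * v 0 * z 1 ^ 2 + 6 * f3 (z 0) * z 1 * v 1) * w 3) := by
  have hg0 : 0 < g := hg ▸ Real.rpow_pos_of_pos hf _
  have hg3 : f3 (z 0) = g ^ 3 := by
    rw [← hg, ← Real.rpow_natCast, ← Real.rpow_mul hf.le]; norm_num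
  have hgm : f3 (z 0) ^ ((1 : ℝ) / 3 - 1) = 1 / g ^ 2 := by
    rw [Real.rpow_sub_one hf.ne', hg, hg3]; field_simp
  have hF := hasDerivAt_comp_line (hf3.differentiable (by simp)) (z 0) (v 0)
  have hD := hasDerivAt_comp_line (differentiable_deriv_of_contDiff_infty hf3) (z 0) (v 0)
  have hU := hasDerivAt_coord_line z v 1
  have hP := hasDerivAt_coord_line z v 2
  have hQ := hasDerivAt_coord_line z v 3
  have hR := hasDerivAt_coord_line z v 4
  have hG : HasDerivAt (fun t : ℝ => f3 (z 0 + t * v 0) ^ ((1 : ℝ) / 3))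
      (deriv f3 (z 0) * v 0 / (3 * g ^ 2)) 0 := by
    convert hF.rpow_const (p := (1 : ℝ) / 3) (Or.inl (by simpa using hf.ne')) using 1
    simp only [zero_mul, add_zero, hgm]
    field_simp
  have hden : 3 * f3 (z 0 + 0 * v 0) ^ ((1 : ℝ) / 3) * (z 1 + 0 * v 1) ^ 3 ≠ 0 := by
    simp only [zero_mul, add_zero, hg]; positivity
  have hC := ((hasDerivAt_const (0 : ℝ) (1 : ℝ)).div ((hG.const_mul 3).mul (hU.pow 3)) hden).neg
  have hA := (((((hF.const_mul 3).mul (hU.pow 2)).mul hR).add ((hD.mul (hU.pow 2)).mul hQ)).sub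
    ((hD.mul hU).mul (hP.pow 2))).sub ((((hF.const_mul 9).mul hU).mul hP).mul hQ) |>.add
    ((hF.const_mul 6).mul (hP.pow 3))
  have hB := (((hD.mul hU).mul hP).add (((hF.const_mul 3).mul hU).mul hQ)).sub
    ((hF.const_mul 6).mul (hP.pow 2))
  have hE := (((hF.const_mul 6).mul hP).sub (hD.mul hU)).mul hU
  have hH := (hF.const_mul 3).mul (hU.pow 2)
  have hsum := hC.mul ((((hA.mul_const (w 0)).add (hB.mul_const (w 1))).add
    (hE.mul_const (w 2))).sub (hH.mul_const (w 3)))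
  refine fderiv_apply_eq_of_hasDerivAt_line (differentiableAt_σ4 hf3 hu hf) ?_
  refine (hsum.congr_deriv ?_).congr_of_eventuallyEq (Filter.Eventually.of_forall fun t => ?_)
  · simp only [zero_mul, add_zero, Pi.add_apply, Pi.sub_apply, Pi.mul_apply, Pi.pow_apply,
      Pi.neg_apply, Pi.div_apply, hg]
    field_simp
    ring
  · simp only [σ4, dX, dU, dP, dQ, add_apply, sub_apply, smul_apply,
      ContinuousLinearMap.proj_apply, smul_eq_mul, Pi.add_apply, Pi.sub_apply, Pi.mul_apply,
      Pi.pow_apply, Pi.neg_apply, Pi.div_apply, Pi.smul_apply]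

/-- The final structure equations of the gauge equivalence problem:
`dθ⁴ = I₁θ¹∧θ³ + I₂θ¹∧θ⁴ + θ¹∧θ⁵` and `dθ⁵ = 0` on `Ω`, where `I₁, I₂` are the
fundamental invariants. -/
theorem gauge_final_structure_eqs
    (f0 f1 f2 f3 : ℝ → ℝ)
    (hf0 : ContDiff ℝ (⊤ : ℕ∞) f0) (hf1 : ContDiff ℝ (⊤ : ℕ∞) f1)
    (hf2 : ContDiff ℝ (⊤ : ℕ∞) f2) (hf3 : ContDiff ℝ (⊤ : ℕ∞) f3) :
    ∀ z ∈ Omega f3, ∀ v w : E5,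
      extD (σ4 f3) z v w =
        I1g f1 f2 f3 z * wedge (σ1 f3) (σ3 f3) z v w +
          I2g f2 f3 z * wedge (σ1 f3) (σ4 f3) z v w +
          wedge (σ1 f3) (ω5g f0 f1 f2 f3) z v w ∧
      extD (ω5g f0 f1 f2 f3) z v w = 0 := by
  rintro z ⟨hu, hf⟩ v w
  have hu' : z 1 ≠ 0 := hu.ne'
  constructor
  · obtain ⟨g, hg⟩ : ∃ g, f3 (z 0) ^ ((1 : ℝ) / 3) = g := ⟨_, rfl⟩
    have hg0 : 0 < g := hg ▸ Real.rpow_pos_of_pos hf _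
    have hg3 : f3 (z 0) = g ^ 3 := by
      rw [← hg, ← Real.rpow_natCast, ← Real.rpow_mul hf.le]; norm_num
    have hg2 : f3 (z 0) ^ ((2 : ℝ) / 3) = g ^ 2 := by
      rw [← hg, ← Real.rpow_natCast, ← Real.rpow_mul hf.le]; norm_num
    have hg4 : f3 (z 0) ^ ((4 : ℝ) / 3) = g ^ 4 := by
      rw [← hg, ← Real.rpow_natCast, ← Real.rpow_mul hf.le]; norm_num
    have hgi : f3 (z 0) ^ (-(1 : ℝ) / 3) = g⁻¹ := by
      rw [← hg, ← Real.rpow_neg hf.le]; norm_num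
    rw [extD, fderiv_σ4_apply hf3 hu' hf hg, fderiv_σ4_apply hf3 hu' hf hg]
    simp only [wedge, σ1, σ3, σ4, ω5g, I1g, I2g, dX, dU, dP, dQ, dR,
      add_apply, sub_apply,
      smul_apply, ContinuousLinearMap.proj_apply, smul_eq_mul,
      hg, hg2, hg4, hgi]
    rw [hg3]
    field_simp
    ring
  · rw [extD, fderiv_ω5g_apply hf0 hf1 hf2 hf3 hu', fderiv_ω5g_apply hf0 hf1 hf2 hf3 hu']
    field_simp
    ring
end
end

section
/- Let f₀, f₁, f₂, f₃ : ℝ → ℝ be smooth and let Ω = {(x,u,p,q,r) ∈ ℝ⁵ : u > 0, f₃(x) > 0}. Let θ¹, …, θ⁵ be the gauge-invariant coframe: θ¹ = f₃^{−1/3}dx, θ² = (du − p dx)/u, θ³ = (f₃^{1/3}/u²)[(p² − qu)dx − p du + u dp], θ⁴ = −(1/(3f₃^{1/3}u³))[(3f₃u²r + f₃'u²q − f₃'up² − 9f₃upq + 6f₃p³)dx + (f₃'up + 3f₃uq − 6f₃p²)du + (6f₃p − f₃'u)u dp − 3f₃u² dq], θ⁵ = ((f₃'r + f₂'q + f₁'p)/u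 + f₀')dx − ((f₃r + f₂q + f₁p)/u²)du + (f₁/u)dp + (f₂/u)dq + (f₃/u)dr. Define the vector fields X₁ = f₃^{1/3}(∂_x + p∂_u + q∂_p + r∂_q + R∂_r) with R = −(f₂ru + f₁qu − f₁p² − f₂pq − f₃pr + f₃'ru + f₂'qu + f₁'pu + f₀'u²)/(f₃u); X₂ = u∂_u + p∂_p + q∂_q + r∂_r; X₃ = (u/f₃^{1/3})∂_p + ((6f₃p − f₃'u)/(3f₃^{4/3}))∂_q + (((f₂f₃' − 3f₁f₃)u − 6f₂f₃p)/(3f₃^{7/3}))∂_r; X₄ = (u/f₃^{2/3})∂_q − (f₂u/f₃^{5/3})∂_r; X₅ = (u/f₃)∂_r. Then at every point of Ω one has θⁱ(Xⱼ) = δⁱⱼ for all 1 ≤ i, j ≤ 5; i.e., (X₁, …, X₅) is the frame dual to the gauge-invariant coframe, so the coframe derivative ∂F/∂θʲ of any function F equals XⱼF. -/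
noncomputable section

open Real Set

/-- The vector field `X₁ = f₃^{1/3}(∂ₓ + p∂ᵤ + q∂ₚ + r∂_q + R∂ᵣ)` of the gauge
problem, with `R` as in the text. -/
def Y1 (f0 f1 f2 f3 : ℝ → ℝ) : E5 → E5 := fun z =>
  ((f3 (z 0)) ^ ((1 : ℝ) / 3)) •
    ![1, z 2, z 3, z 4,
      -(f2 (z 0) * z 4 * z 1 + f1 (z 0) * z 3 * z 1 - f1 (z 0) * (z 2) ^ 2 -
          f2 (z 0) * z 2 * z 3 - f3 (z 0) * z 2 * z 4 + deriv f3 (z 0) * z 4 * z 1 +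
          deriv f2 (z 0) * z 3 * z 1 + deriv f1 (z 0) * z 2 * z 1 +
          deriv f0 (z 0) * (z 1) ^ 2) / (f3 (z 0) * z 1)]

/-- The vector field `X₂ = u∂ᵤ + p∂ₚ + q∂_q + r∂ᵣ` of the gauge problem. -/
def Y2 : E5 → E5 := fun z => ![0, z 1, z 2, z 3, z 4]

/-- The vector field `X₃` of the gauge problem. -/
def Y3 (f1 f2 f3 : ℝ → ℝ) : E5 → E5 := fun z =>
  ![0, 0, z 1 / (f3 (z 0)) ^ ((1 : ℝ) / 3),
    (6 * f3 (z 0) * z 2 - deriv f3 (z 0) * z 1) / (3 * (f3 (z 0)) ^ ((4 : ℝ) / 3)),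
    ((f2 (z 0) * deriv f3 (z 0) - 3 * f1 (z 0) * f3 (z 0)) * z 1 -
        6 * f2 (z 0) * f3 (z 0) * z 2) / (3 * (f3 (z 0)) ^ ((7 : ℝ) / 3))]

/-- The vector field `X₄ = (u/f₃^{2/3})∂_q − (f₂u/f₃^{5/3})∂ᵣ` of the gauge problem. -/
def Y4 (f2 f3 : ℝ → ℝ) : E5 → E5 := fun z =>
  ![0, 0, 0, z 1 / (f3 (z 0)) ^ ((2 : ℝ) / 3),
    -(f2 (z 0) * z 1) / (f3 (z 0)) ^ ((5 : ℝ) / 3)]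

/-- The vector field `X₅ = (u/f₃)∂ᵣ` of the gauge problem. -/
def Y5 (f3 : ℝ → ℝ) : E5 → E5 := fun z => ![0, 0, 0, 0, z 1 / f3 (z 0)]

/-- Real powers with exponent `n / 3` are integer powers of the cube root. -/
theorem rpow_div_three {a : ℝ} (ha : 0 ≤ a) (n : ℕ) :
    a ^ ((n : ℝ) / 3) = (a ^ ((1 : ℝ) / 3)) ^ n := by
  rw [← Real.rpow_natCast, ← Real.rpow_mul ha]
  congr 1
  ring

/-- `(X₁, …, X₅)` is the frame dual to the gauge-invariant coframe
`(θ¹, …, θ⁵)`: `θⁱ(Xⱼ) = δⁱⱼ` on `Ω`. -/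
theorem gauge_dual_frame
    (f0 f1 f2 f3 : ℝ → ℝ)
    (hf0 : ContDiff ℝ (⊤ : ℕ∞) f0) (hf1 : ContDiff ℝ (⊤ : ℕ∞) f1)
    (hf2 : ContDiff ℝ (⊤ : ℕ∞) f2) (hf3 : ContDiff ℝ (⊤ : ℕ∞) f3) :
    ∀ z ∈ Omega f3, ∀ i j : Fin 5,
      (![σ1 f3, ω2, σ3 f3, σ4 f3, ω5g f0 f1 f2 f3] i) z
          ((![Y1 f0 f1 f2 f3, Y2, Y3 f1 f2 f3, Y4 f2 f3, Y5 f3] j) z) =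
        if i = j then 1 else 0 := by
  rintro z ⟨hu, ha⟩ i j
  have h1 : f3 (z 0) ^ (-(1 : ℝ) / 3) = (f3 (z 0) ^ ((1 : ℝ) / 3))⁻¹ := by
    rw [← Real.rpow_neg ha.le]
    congr 1
    ring
  have h2 := rpow_div_three ha.le 2
  have h3 := rpow_div_three ha.le 3
  have h4 := rpow_div_three ha.le 4
  have h5 := rpow_div_three ha.le 5
  have h7 := rpow_div_three ha.le 7
  have hc : 0 < f3 (z 0) ^ ((1 : ℝ) / 3) := Real.rpow_pos_of_pos ha _
  push_cast at h2 h3 h4 h5 h7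
  rw [div_self (three_ne_zero), Real.rpow_one] at h3
  have hu' := hu.ne'
  fin_cases i <;> fin_cases j <;>
    simp [σ1, ω2, σ3, σ4, ω5g, Y1, Y2, Y3, Y4, Y5, dX, dU, dP, dQ, dR,
      -one_div, -mul_eq_zero, h1, h2, h4, h5, h7] <;>
    generalize f3 (z 0) ^ ((1 : ℝ) / 3) = c at * <;>
    have hc' := hc.ne' <;>
    (try rw [h3]) <;>
    field_simp <;>
    ring
end
end

section
/- Let f₀, f₁, f₂, f₃ : ℝ → ℝ be smooth and let Ω = {(x,u,p,q,r) ∈ ℝ⁵ : u > 0, f₃(x) > 0}. Define the fundamental invariants of the gauge equivalence problem I₁ = [ (f₃f₃'' − 3f₁f₃ + f₂f₃' − (4/3)f₃'²)u + 3(f₃f₃' − 2f₂f₃)p − 9f₃²q ] / (3f₃^{4/3}u) and I₂ = (f₃'u − 3f₃p − f₂u)/(f₃^{2/3}u), and the coframe-derivative vector fields X₂ = u∂_u + p∂_p + q∂_q + r∂_r, X₃ = (u/f₃^{1/3})∂_p + ((6f₃p − f₃'u)/(3f₃^{4/3}))∂_q + (((f₂f₃' − 3f₁f₃)u − 6f₂f₃p)/(3f₃^{7/3}))∂_r,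 X₄ = (u/f₃^{2/3})∂_q − (f₂u/f₃^{5/3})∂_r, X₅ = (u/f₃)∂_r. Then the following syzygies among the invariants hold at every point of Ω: X₄I₁ = −3, X₃I₂ = −3 (so X₄I₁ = X₃I₂, as forced by the Jacobi identity d²θ⁴ = 0), X₃I₁ = 2·I₂, and X₂I₁ = X₂I₂ = X₅I₁ = X₅I₂ = 0. -/
noncomputable section

open Real Set

/-- The derivative of a quotient of forms linear in the fibre coordinates, with coefficients
depending on `x` only, along a vector with vanishing `x`-component. -/
theorem fderiv_fibre_quotient {a b c d : ℝ → ℝ} {z v : E5}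
    (ha : DifferentiableAt ℝ a (z 0)) (hb : DifferentiableAt ℝ b (z 0))
    (hc : DifferentiableAt ℝ c (z 0)) (hd : DifferentiableAt ℝ d (z 0))
    (hdz : d (z 0) ≠ 0) (hz : z 1 ≠ 0) (hv : v 0 = 0) :
    fderiv ℝ (fun w : E5 => (a (w 0) * w 1 + b (w 0) * w 2 + c (w 0) * w 3) /
        (d (w 0) * w 1)) z v =
      (b (z 0) * (v 2 * z 1 - z 2 * v 1) + c (z 0) * (v 3 * z 1 - z 3 * v 1)) /
        (d (z 0) * z 1 ^ 2) := by
  have hcoord (i : Fin 5) : DifferentiableAt ℝ (fun w : E5 => w i) z := by fun_prop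
  have hcomp {g : ℝ → ℝ} (hg : DifferentiableAt ℝ g (z 0)) :
      DifferentiableAt ℝ (fun w : E5 => g (w 0)) z :=
    DifferentiableAt.comp (g := g) z hg (hcoord 0)
  have hnum := (((hcomp ha).fun_mul (hcoord 1)).fun_add ((hcomp hb).fun_mul (hcoord 2))).fun_add
    ((hcomp hc).fun_mul (hcoord 3))
  have hden := (hcomp hd).fun_mul (hcoord 1)
  have hF : DifferentiableAt ℝ (fun w : E5 => (a (w 0) * w 1 + b (w 0) * w 2 + c (w 0) * w 3) /
      (d (w 0) * w 1)) z := by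
    simpa only [div_eq_mul_inv] using hnum.fun_mul (hden.fun_inv (mul_ne_zero hdz hz))
  rw [← hF.lineDeriv_eq_fderiv, lineDeriv]
  have hlin (i : Fin 5) : HasDerivAt (fun t : ℝ => z i + t * v i) (v i) 0 := by
    simpa using ((hasDerivAt_id (0 : ℝ)).mul_const (v i)).const_add (z i)
  have hline := ((((hlin 1).const_mul (a (z 0))).add ((hlin 2).const_mul (b (z 0)))).add
    ((hlin 3).const_mul (c (z 0)))).div ((hlin 1).const_mul (d (z 0))) (by simp [hdz, hz])
  refine (hline.congr_of_eventuallyEq (.of_forall fun t => ?_)).deriv.trans ?_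
  · simp [hv]
  simp only [Pi.add_apply, zero_mul, add_zero]
  field_simp
  ring

/-- The derivative of `I₁` along a vector with vanishing `x`-component. -/
theorem fderiv_I1g {f1 f2 f3 : ℝ → ℝ} (hf1 : ContDiff ℝ (⊤ : ℕ∞) f1)
    (hf2 : ContDiff ℝ (⊤ : ℕ∞) f2) (hf3 : ContDiff ℝ (⊤ : ℕ∞) f3)
    {z v : E5} (hz : z ∈ Omega f3) (hv : v 0 = 0) :
    fderiv ℝ (I1g f1 f2 f3) z v =
      (3 * (f3 (z 0) * deriv f3 (z 0) - 2 * f2 (z 0) * f3 (z 0)) * (v 2 * z 1 - z 2 * v 1) +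
        -(9 * f3 (z 0) ^ 2) * (v 3 * z 1 - z 3 * v 1)) /
        (3 * f3 (z 0) ^ ((4 : ℝ) / 3) * z 1 ^ 2) := by
  have d1 : Differentiable ℝ f1 := hf1.differentiable (by simp)
  have d2 : Differentiable ℝ f2 := hf2.differentiable (by simp)
  have d3 : Differentiable ℝ f3 := hf3.differentiable (by simp)
  have hf3' : ContDiff ℝ (⊤ : ℕ∞) (deriv f3) := (contDiff_infty_iff_deriv.1 hf3).2
  have d3' : Differentiable ℝ (deriv f3) := hf3'.differentiable (by simp)
  have d3'' : Differentiable ℝ (deriv (deriv f3)) :=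
    (contDiff_infty_iff_deriv.1 hf3').2.differentiable (by simp)
  rw [← fderiv_fibre_quotient
    (a := fun x => f3 x * deriv (deriv f3) x - 3 * f1 x * f3 x + f2 x * deriv f3 x -
      (4 / 3) * deriv f3 x ^ 2)
    (b := fun x => 3 * (f3 x * deriv f3 x - 2 * f2 x * f3 x))
    (c := fun x => -(9 * f3 x ^ 2)) (d := fun x => 3 * f3 x ^ ((4 : ℝ) / 3))
    (by fun_prop) (by fun_prop) (by fun_prop)
    (((d3 _).rpow_const (Or.inl hz.2.ne')).const_mul 3)
    (mul_ne_zero three_ne_zero (rpow_pos_of_pos hz.2 _).ne') hz.1.ne' hv]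
  congr 2
  funext w
  simp only [I1g]
  ring

/-- The derivative of `I₂` along a vector with vanishing `x`-component. -/
theorem fderiv_I2g {f2 f3 : ℝ → ℝ}
    (hf2 : ContDiff ℝ (⊤ : ℕ∞) f2) (hf3 : ContDiff ℝ (⊤ : ℕ∞) f3)
    {z v : E5} (hz : z ∈ Omega f3) (hv : v 0 = 0) :
    fderiv ℝ (I2g f2 f3) z v =
      -(3 * f3 (z 0)) * (v 2 * z 1 - z 2 * v 1) / (f3 (z 0) ^ ((2 : ℝ) / 3) * z 1 ^ 2) := by
  have d2 : Differentiable ℝ f2 := hf2.differentiable (by simp)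
  have d3 : Differentiable ℝ f3 := hf3.differentiable (by simp)
  have d3' : Differentiable ℝ (deriv f3) :=
    (contDiff_infty_iff_deriv.1 hf3).2.differentiable (by simp)
  have h := fderiv_fibre_quotient (z := z) (v := v)
    (a := fun x => deriv f3 x - f2 x) (b := fun x => -(3 * f3 x)) (c := fun _ => 0)
    (d := fun x => f3 x ^ ((2 : ℝ) / 3))
    (by fun_prop) (by fun_prop) (by fun_prop)
    ((d3 _).rpow_const (Or.inl hz.2.ne'))
    (rpow_pos_of_pos hz.2 _).ne' hz.1.ne' hv
  rw [zero_mul, add_zero] at h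
  rw [← h]
  congr 2
  funext w
  simp only [I2g]
  ring

/-- The syzygies among the fundamental invariants of the gauge
equivalence problem: `X₄I₁ = −3`, `X₃I₂ = −3`, `X₃I₁ = 2I₂`, and
`X₂I₁ = X₂I₂ = X₅I₁ = X₅I₂ = 0` on `Ω`. -/
theorem gauge_syzygies
    (f0 f1 f2 f3 : ℝ → ℝ)
    (hf0 : ContDiff ℝ (⊤ : ℕ∞) f0) (hf1 : ContDiff ℝ (⊤ : ℕ∞) f1)
    (hf2 : ContDiff ℝ (⊤ : ℕ∞) f2) (hf3 : ContDiff ℝ (⊤ : ℕ∞) f3) :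
    ∀ z ∈ Omega f3,
      fderiv ℝ (I1g f1 f2 f3) z (Y4 f2 f3 z) = -3 ∧
      fderiv ℝ (I2g f2 f3) z (Y3 f1 f2 f3 z) = -3 ∧
      fderiv ℝ (I1g f1 f2 f3) z (Y3 f1 f2 f3 z) = 2 * I2g f2 f3 z ∧
      fderiv ℝ (I1g f1 f2 f3) z (Y2 z) = 0 ∧
      fderiv ℝ (I2g f2 f3) z (Y2 z) = 0 ∧
      fderiv ℝ (I1g f1 f2 f3) z (Y5 f3 z) = 0 ∧
      fderiv ℝ (I2g f2 f3) z (Y5 f3 z) = 0 := by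
  intro z hz
  have hu : z 1 ≠ 0 := hz.1.ne'
  set s := f3 (z 0) ^ ((1 : ℝ) / 3) with hs
  have hs0 : s ≠ 0 := (rpow_pos_of_pos hz.2 _).ne'
  have hpow (n : ℕ) : f3 (z 0) ^ ((n : ℝ) / 3) = s ^ n := by
    rw [hs, ← rpow_natCast, ← rpow_mul hz.2.le]
    ring_nf
  have h2 : f3 (z 0) ^ ((2 : ℝ) / 3) = s ^ 2 := hpow 2
  have h3 : f3 (z 0) = s ^ 3 := by simpa using hpow 3
  have h4 : f3 (z 0) ^ ((4 : ℝ) / 3) = s ^ 4 := hpow 4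
  refine ⟨?_, ?_, ?_, ?_, ?_, ?_, ?_⟩
  · rw [fderiv_I1g hf1 hf2 hf3 hz rfl]
    simp only [Y4, Matrix.cons_val, h2, h4]
    rw [h3]
    field_simp
    ring
  · rw [fderiv_I2g hf2 hf3 hz rfl]
    simp only [Y3, Matrix.cons_val, h2, ← hs]
    rw [h3]
    field_simp
    ring
  · rw [fderiv_I1g hf1 hf2 hf3 hz rfl]
    simp only [Y3, I2g, Matrix.cons_val, h2, h4, ← hs]
    rw [h3]
    field_simp
    ring
  · rw [fderiv_I1g hf1 hf2 hf3 hz rfl]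
    simp only [Y2, Matrix.cons_val]
    ring
  · rw [fderiv_I2g hf2 hf3 hz rfl]
    simp only [Y2, Matrix.cons_val]
    ring
  · rw [fderiv_I1g hf1 hf2 hf3 hz rfl]
    simp only [Y5, Matrix.cons_val]
    ring
  · rw [fderiv_I2g hf2 hf3 hz rfl]
    simp only [Y5, Matrix.cons_val]
    ring
end
end
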